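/- arXiv:2011.04630 — 3 statements merged into one kernel-verified Lean document; each statement's English description precedes it below -/
import Mathlib

section
/- Let E_log(n) denote the infimum, over all n-tuples of pairwise distinct points x₁,…,xₙ on the unit sphere S² ⊂ ℝ³, of the logarithmic energy ∑_{i≠j} log(1/‖x_i − x_j‖). Then liminf_{n→∞} ( E_log(n) − (1/2 − log 2)·n² + (n·log n)/2 ) / n ≥ (log 4 − 1 − γ)/2, where γ is the Euler–Mascheroni constant. (Numerically, (log 4 − 1 − γ)/2 ≈ −0.0954.) -/
open MeasureTheory Real Filter Finset

/-- The minimal logarithmic energy of `n` points on the unit sphere `S² ⊂ ℝ³`: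
the infimum over all `n`-tuples of pairwise distinct points on the sphere of
`∑_{i ≠ j} log (1/‖x_i - x_j‖)`. -/
noncomputable def minLogEnergy (n : ℕ) : ℝ :=
  sInf { E : ℝ | ∃ x : Fin n → EuclideanSpace ℝ (Fin 3),
    (∀ i, ‖x i‖ = 1) ∧ Function.Injective x ∧
    E = ∑ i : Fin n, ∑ j ∈ Finset.univ \ {i}, Real.log (1 / ‖x i - x j‖) }

/-! ### The entire exponential integral -/

/-- The continuous extension of `t ↦ (1 - exp (-t)) / t`. -/
noncomputable def einIntegrand : ℝ → ℝ := dslope (fun t => -exp (-t)) 0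

/-- The entire exponential integral `Ein z = ∫₀ᶻ (1 - exp (-t)) / t dt`. -/
noncomputable def ein (z : ℝ) : ℝ := ∫ t in (0 : ℝ)..z, einIntegrand t

lemma einIntegrand_of_ne {t : ℝ} (ht : t ≠ 0) : einIntegrand t = (1 - exp (-t)) / t := by
  rw [einIntegrand, dslope_of_ne _ ht, slope_def_field]
  simp
  ring

lemma hasDerivAt_neg_exp_neg (t : ℝ) : HasDerivAt (fun t => -exp (-t)) (exp (-t)) t := by
  simpa using ((hasDerivAt_neg t).exp).fun_neg

lemma einIntegrand_zero : einIntegrand 0 = 1 := by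
  rw [einIntegrand, dslope_same, (hasDerivAt_neg_exp_neg 0).deriv]
  simp

lemma continuous_einIntegrand : Continuous einIntegrand := by
  rw [← continuousOn_univ, einIntegrand, continuousOn_dslope Filter.univ_mem]
  exact ⟨by fun_prop, (hasDerivAt_neg_exp_neg 0).differentiableAt⟩

lemma ein_zero : ein 0 = 0 := by simp [ein]

lemma hasDerivAt_ein (z : ℝ) : HasDerivAt ein (einIntegrand z) z :=
  intervalIntegral.integral_hasDerivAt_right (continuous_einIntegrand.intervalIntegrable _ _)
    (continuous_einIntegrand.stronglyMeasurableAtFilter _ _) continuous_einIntegrand.continuousAt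

lemma continuous_ein : Continuous ein :=
  continuous_iff_continuousAt.2 fun z => (hasDerivAt_ein z).continuousAt

lemma exp_neg_sub_le_one_sub_div_pow {n : ℕ} {s : ℝ} (hn : 0 < n) (hs : 0 ≤ s) (hsn : s ≤ n) :
    exp (-s) - s ^ 2 * exp (-s) / n ≤ (1 - s / n) ^ n := by
  have hn' : (0 : ℝ) < n := by exact_mod_cast hn
  set y : ℝ := s / n with hy
  have hy0 : 0 ≤ y := by positivity
  have hy1 : y ≤ 1 := by rw [hy, div_le_one hn']; exact hsn
  have hbase : exp (-y) * (1 - y ^ 2) ≤ 1 - y := by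
    have h1 : exp (-y) * (1 + y) ≤ 1 := by
      have := Real.add_one_le_exp y
      calc exp (-y) * (1 + y) ≤ exp (-y) * exp y := by gcongr; linarith
        _ = 1 := by rw [← Real.exp_add]; simp
    nlinarith
  have hbern : 1 - n * y ^ 2 ≤ (1 - y ^ 2) ^ n := by
    have := one_add_mul_le_pow (a := -y ^ 2) (by nlinarith) n
    calc 1 - n * y ^ 2 = 1 + n * (-y ^ 2) := by ring
      _ ≤ (1 + -y ^ 2) ^ n := this
      _ = _ := by ring
  have hpow : (exp (-y) * (1 - y ^ 2)) ^ n ≤ (1 - y) ^ n :=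
    pow_le_pow_left₀ (mul_nonneg (exp_pos _).le (by nlinarith)) hbase n
  have hexp : exp (-y) ^ n = exp (-s) := by
    rw [← Real.exp_nat_mul, hy]; congr 1; field_simp
  rw [mul_pow, hexp] at hpow
  calc exp (-s) - s ^ 2 * exp (-s) / n = exp (-s) * (1 - n * y ^ 2) := by
        rw [hy]; field_simp
    _ ≤ exp (-s) * (1 - y ^ 2) ^ n := by gcongr
    _ ≤ _ := hpow

lemma harmonic_eq_integral {n : ℕ} (hn : 0 < n) :
    (harmonic n : ℝ) = ∫ s in (0 : ℝ)..n, (∑ k ∈ range n, (1 - s / n) ^ k) / n := by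
  have hn' : (n : ℝ) ≠ 0 := by exact_mod_cast hn.ne'
  have hk (k : ℕ) : ∫ s in (0 : ℝ)..n, (1 - s / n) ^ k = n * ((k : ℝ) + 1)⁻¹ := by
    rw [intervalIntegral.integral_comp_sub_div (fun x => x ^ k) hn']
    simp [integral_pow, hn']
  rw [intervalIntegral.integral_div, intervalIntegral.integral_finsetSum]
  · simp_rw [hk, ← Finset.mul_sum]
    rw [harmonic]
    push_cast
    field_simp
  · intro k _
    exact Continuous.intervalIntegrable (by fun_prop) _ _

lemma geom_sum_one_sub_div {n : ℕ} {s : ℝ} (hn : 0 < n) (hs : s ≠ 0) :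
    (∑ k ∈ range n, (1 - s / n) ^ k) / n = (1 - (1 - s / n) ^ n) / s := by
  have hn' : (n : ℝ) ≠ 0 := by exact_mod_cast hn.ne'
  have h := geom_sum_mul_neg (1 - s / n : ℝ) n
  rw [← h]
  field_simp
  ring

lemma ein_le_harmonic {n : ℕ} (hn : 0 < n) : ein n ≤ harmonic n := by
  rw [harmonic_eq_integral hn, ein]
  refine intervalIntegral.integral_mono_on_of_le_Ioo (Nat.cast_nonneg n)
    (continuous_einIntegrand.intervalIntegrable _ _)
    (Continuous.intervalIntegrable (by fun_prop) _ _) fun s hs => ?_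
  rw [geom_sum_one_sub_div hn hs.1.ne', einIntegrand_of_ne hs.1.ne']
  have := Real.one_sub_div_pow_le_exp_neg hs.2.le
  have := hs.1
  gcongr

lemma integral_mul_exp_neg_le_one {a : ℝ} (ha : 0 ≤ a) :
    ∫ s in (0 : ℝ)..a, s * exp (-s) ≤ 1 := by
  have hd (s : ℝ) : HasDerivAt (fun s => (s + 1) * -exp (-s)) (s * exp (-s)) s := by
    refine (((hasDerivAt_id' s).add_const 1).fun_mul (hasDerivAt_neg_exp_neg s)).congr_deriv ?_
    ring
  rw [intervalIntegral.integral_eq_sub_of_hasDerivAt (fun s _ => hd s)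
    (Continuous.intervalIntegrable (by fun_prop) _ _)]
  have : 0 ≤ (a + 1) * exp (-a) := by positivity
  simp
  linarith

lemma harmonic_le_ein_add {n : ℕ} (hn : 0 < n) : (harmonic n : ℝ) ≤ ein n + 1 / n := by
  have hn' : (0 : ℝ) < n := by exact_mod_cast hn
  have hint : (harmonic n : ℝ) ≤ ∫ s in (0 : ℝ)..n, (einIntegrand s + s * exp (-s) / n) := by
    rw [harmonic_eq_integral hn]
    refine intervalIntegral.integral_mono_on_of_le_Ioo (Nat.cast_nonneg n)
      (Continuous.intervalIntegrable (by fun_prop) _ _)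
      (Continuous.intervalIntegrable (continuous_einIntegrand.add (by fun_prop)) _ _)
      fun s hs => ?_
    have hs0 : 0 < s := hs.1
    rw [geom_sum_one_sub_div hn hs0.ne', einIntegrand_of_ne hs0.ne']
    have := exp_neg_sub_le_one_sub_div_pow hn hs0.le hs.2.le
    calc (1 - (1 - s / n) ^ n) / s ≤ (1 - (exp (-s) - s ^ 2 * exp (-s) / n)) / s := by gcongr
      _ = _ := by field_simp; ring
  rw [intervalIntegral.integral_add (continuous_einIntegrand.intervalIntegrable _ _)
    (Continuous.intervalIntegrable (by fun_prop) _ _), intervalIntegral.integral_div] at hint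
  refine hint.trans ?_
  have := integral_mul_exp_neg_le_one hn'.le
  rw [ein]
  gcongr

lemma tendsto_ein_sub_log :
    Tendsto (fun n : ℕ => ein n - log n) atTop (nhds eulerMascheroniConstant) := by
  have hlow : Tendsto (fun n : ℕ => (harmonic n : ℝ) - log n - 1 / n) atTop
      (nhds eulerMascheroniConstant) := by
    simpa using tendsto_harmonic_sub_log.sub tendsto_one_div_atTop_nhds_zero_nat
  refine tendsto_of_tendsto_of_tendsto_of_le_of_le' hlow tendsto_harmonic_sub_log ?_ ?_
  · filter_upwards [eventually_gt_atTop 0] with n hn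
    linarith [harmonic_le_ein_add hn]
  · filter_upwards [eventually_gt_atTop 0] with n hn
    linarith [ein_le_harmonic hn]

lemma hasDerivAt_ein_sub_log {z : ℝ} (hz : 0 < z) :
    HasDerivAt (fun z => ein z - log z) (-(exp (-z) / z)) z := by
  refine ((hasDerivAt_ein z).fun_sub (hasDerivAt_log hz.ne')).congr_deriv ?_
  rw [einIntegrand_of_ne hz.ne']
  field_simp
  ring

lemma hasDerivAt_exp_neg_div {z : ℝ} (hz : 0 < z) :
    HasDerivAt (fun z => exp (-z) / z) (-(exp (-z) / z) - exp (-z) / z ^ 2) z := by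
  refine (((hasDerivAt_neg z).exp).fun_div (hasDerivAt_id' z) hz.ne').congr_deriv ?_
  field_simp

/-- Nonnegativity of the exponential integral `E₁ z = Ein z - log z - γ`. -/
lemma eulerMascheroniConstant_add_log_le_ein {z : ℝ} (hz : 0 < z) :
    eulerMascheroniConstant + log z ≤ ein z := by
  have hanti : AntitoneOn (fun z => ein z - log z) (Set.Ioi 0) := by
    refine antitoneOn_of_deriv_nonpos (convex_Ioi 0)
      (fun x hx => (hasDerivAt_ein_sub_log hx).continuousAt.continuousWithinAt) ?_ ?_ <;>
      rw [interior_Ioi] <;> intro x (hx : 0 < x)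
    · exact (hasDerivAt_ein_sub_log hx).differentiableAt.differentiableWithinAt
    · rw [(hasDerivAt_ein_sub_log hx).deriv]
      have : 0 ≤ exp (-x) / x := by positivity
      linarith
  have : eulerMascheroniConstant ≤ ein z - log z := by
    refine le_of_tendsto tendsto_ein_sub_log ?_
    filter_upwards [tendsto_natCast_atTop_atTop.eventually_ge_atTop z] with n hn
    exact hanti hz (hz.trans_le hn) hn
  linarith

/-- The bound `E₁ z ≤ exp (-z) / z` for the exponential integral `E₁ z = Ein z - log z - γ`. -/
lemma ein_le_eulerMascheroniConstant_add_log_add {z : ℝ} (hz : 0 < z) :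
    ein z ≤ eulerMascheroniConstant + log z + exp (-z) / z := by
  have hderiv {x : ℝ} (hx : 0 < x) :=
    (hasDerivAt_ein_sub_log hx).sub (hasDerivAt_exp_neg_div hx)
  have hmono : MonotoneOn ((fun z => ein z - log z) - fun z => exp (-z) / z) (Set.Ioi 0) := by
    refine monotoneOn_of_deriv_nonneg (convex_Ioi 0)
      (fun x hx => (hderiv hx).continuousAt.continuousWithinAt) ?_ ?_ <;>
      rw [interior_Ioi] <;> intro x (hx : 0 < x)
    · exact (hderiv hx).differentiableAt.differentiableWithinAt
    · rw [(hderiv hx).deriv]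
      have : 0 ≤ exp (-x) / x ^ 2 := by positivity
      linarith
  have : ein z - log z - exp (-z) / z ≤ eulerMascheroniConstant := by
    refine ge_of_tendsto tendsto_ein_sub_log ?_
    filter_upwards [tendsto_natCast_atTop_atTop.eventually_ge_atTop z] with n hn
    have hn0 : (0 : ℝ) < n := hz.trans_le hn
    have h := hmono hz hn0 hn
    have : 0 ≤ exp (-(n : ℝ)) / n := by positivity
    simp only [Pi.sub_apply] at h
    linarith
  linarith

/-! ### Positive definiteness on the sphere -/

/-- The Welch bound: a lower bound for the squared Frobenius norm of a frame operator by its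
trace. -/
lemma sq_sum_norm_sq_le_card_mul_sum_norm_inner_sq {ι κ : Type*} [Fintype ι] [Fintype κ]
    (w : ι → κ → ℂ) :
    (∑ i, ∑ l, Complex.normSq (w i l)) ^ 2 ≤
      Fintype.card κ * ∑ i, ∑ j, Complex.normSq (∑ l, starRingEnd ℂ (w i l) * w j l) := by
  set F : κ → κ → ℂ := fun l m => ∑ i, starRingEnd ℂ (w i l) * w i m with hF
  have hfrob : ∑ i, ∑ j, Complex.normSq (∑ l, starRingEnd ℂ (w i l) * w j l) =
      ∑ l, ∑ m, Complex.normSq (F l m) := by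
    have : (∑ i, ∑ j, (Complex.normSq (∑ l, starRingEnd ℂ (w i l) * w j l) : ℂ)) =
        ∑ l, ∑ m, (Complex.normSq (F l m) : ℂ) := by
      simp only [Complex.normSq_eq_conj_mul_self, hF, map_sum, map_mul, Complex.conj_conj,
        Finset.sum_mul_sum]
      calc ∑ i, ∑ j, ∑ l, ∑ m, w i l * starRingEnd ℂ (w j l) * (starRingEnd ℂ (w i m) * w j m)
          = ∑ i, ∑ l, ∑ j, ∑ m,
              w i l * starRingEnd ℂ (w j l) * (starRingEnd ℂ (w i m) * w j m) :=
            Finset.sum_congr rfl fun i _ => Finset.sum_comm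
        _ = ∑ l, ∑ i, ∑ j, ∑ m,
              w i l * starRingEnd ℂ (w j l) * (starRingEnd ℂ (w i m) * w j m) :=
            Finset.sum_comm
        _ = ∑ l, ∑ i, ∑ m, ∑ j,
              w i l * starRingEnd ℂ (w j l) * (starRingEnd ℂ (w i m) * w j m) :=
            Finset.sum_congr rfl fun l _ => Finset.sum_congr rfl fun i _ => Finset.sum_comm
        _ = ∑ l, ∑ m, ∑ i, ∑ j,
              w i l * starRingEnd ℂ (w j l) * (starRingEnd ℂ (w i m) * w j m) :=
            Finset.sum_congr rfl fun l _ => Finset.sum_comm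
        _ = _ := by
            refine Finset.sum_congr rfl fun l _ => Finset.sum_congr rfl fun m _ =>
              Finset.sum_congr rfl fun i _ => Finset.sum_congr rfl fun j _ => ?_
            ring
    exact_mod_cast this
  have hdiag (l : κ) : F l l = ((∑ i, Complex.normSq (w i l) : ℝ) : ℂ) := by
    simp [hF, Complex.normSq_eq_conj_mul_self]
  rw [hfrob, Finset.sum_comm]
  calc (∑ l, ∑ i, Complex.normSq (w i l)) ^ 2
      ≤ Fintype.card κ * ∑ l, (∑ i, Complex.normSq (w i l)) ^ 2 := sq_sum_le_card_mul_sum_sq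
    _ ≤ Fintype.card κ * ∑ l, ∑ m, Complex.normSq (F l m) := by
        gcongr with l
        calc (∑ i, Complex.normSq (w i l)) ^ 2 = Complex.normSq (F l l) := by
              rw [hdiag, Complex.normSq_ofReal, sq]
          _ ≤ _ := Finset.single_le_sum (f := fun m => Complex.normSq (F l m))
              (fun m _ => Complex.normSq_nonneg _) (Finset.mem_univ l)

/-- Every point of the unit sphere is the image of a unit spinor under the Hopf map. -/
lemma exists_spinor (x y z : ℝ) (h : x ^ 2 + y ^ 2 + z ^ 2 = 1) :
    ∃ r p q : ℝ, r ^ 2 + p ^ 2 + q ^ 2 = 1 ∧ r ^ 2 - p ^ 2 - q ^ 2 = z ∧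
      2 * r * p = x ∧ 2 * r * q = y := by
  by_cases hz : z = -1
  · subst hz
    have hx : x = 0 := by nlinarith [sq_nonneg x, sq_nonneg y]
    have hy : y = 0 := by nlinarith [sq_nonneg x, sq_nonneg y]
    exact ⟨0, 1, 0, by norm_num, by norm_num, by simp [hx], by simp [hy]⟩
  · have hz' : 0 < 1 + z := by
      have : -1 ≤ z := by nlinarith [sq_nonneg x, sq_nonneg y]
      have := lt_of_le_of_ne this (Ne.symm hz)
      linarith
    set r := √((1 + z) / 2) with hr
    have hr0 : 0 < r := Real.sqrt_pos.2 (by linarith)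
    have hr2 : r ^ 2 = (1 + z) / 2 := Real.sq_sqrt (by linarith)
    have hpq : (x / (2 * r)) ^ 2 + (y / (2 * r)) ^ 2 = (1 - z) / 2 := by
      rw [div_pow, div_pow, mul_pow, hr2, ← add_div, div_eq_iff (by positivity)]
      linarith
    refine ⟨r, x / (2 * r), y / (2 * r), ?_, ?_, ?_, ?_⟩
    · linarith
    · linarith
    · field_simp
    · field_simp

/-- The average of `((1 + ⟪x, y⟫) / 2) ^ k` over pairs of points from a configuration on the
sphere is at least its average `1 / (k + 1)` over the whole sphere. -/
lemma sq_card_div_le_sum_pow {n : ℕ} (x : Fin n → EuclideanSpace ℝ (Fin 3))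
    (hx : ∀ i, ‖x i‖ = 1) (k : ℕ) :
    (n : ℝ) ^ 2 / (k + 1) ≤ ∑ i, ∑ j, (1 - ‖x i - x j‖ ^ 2 / 4) ^ k := by
  have hsq (i : Fin n) : x i 0 ^ 2 + x i 1 ^ 2 + x i 2 ^ 2 = 1 := by
    have := EuclideanSpace.real_norm_sq_eq (x i)
    rw [hx i, Fin.sum_univ_three] at this
    linarith
  choose r p q h1 hz hX hY using fun i => exists_spinor _ _ _ (hsq i)
  set a : Fin n → ℂ := fun i => (r i : ℂ)
  set b : Fin n → ℂ := fun i => ⟨p i, q i⟩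
  have hab (i j : Fin n) :
      Complex.normSq (starRingEnd ℂ (a i) * a j + starRingEnd ℂ (b i) * b j) =
        1 - ‖x i - x j‖ ^ 2 / 4 := by
    have hi := hsq i
    have hj := hsq j
    rw [EuclideanSpace.real_norm_sq_eq, Fin.sum_univ_three]
    simp only [PiLp.sub_apply]
    have hexp : 1 - ((x i 0 - x j 0) ^ 2 + (x i 1 - x j 1) ^ 2 + (x i 2 - x j 2) ^ 2) / 4 =
        (1 + x i 0 * x j 0 + x i 1 * x j 1 + x i 2 * x j 2) / 2 := by
      linear_combination -hi / 4 - hj / 4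
    rw [hexp, ← hX i, ← hX j, ← hY i, ← hY j, ← hz i, ← hz j]
    have hone : (1 : ℝ) = (r i ^ 2 + p i ^ 2 + q i ^ 2) * (r j ^ 2 + p j ^ 2 + q j ^ 2) := by
      rw [h1, h1, one_mul]
    rw [hone]
    simp [a, b, Complex.normSq_apply]
    ring
  set w : Fin n → Fin (k + 1) → ℂ := fun i l =>
    (√(k.choose l) : ℝ) * (a i ^ (l : ℕ) * b i ^ (k - l)) with hw
  have hinner (i j : Fin n) : ∑ l, starRingEnd ℂ (w i l) * w j l =
      (starRingEnd ℂ (a i) * a j + starRingEnd ℂ (b i) * b j) ^ k := by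
    rw [add_pow, Finset.sum_range]
    refine Finset.sum_congr rfl fun l _ => ?_
    have hs : ((√(k.choose l) : ℝ) : ℂ) * (√(k.choose l) : ℝ) = (k.choose l : ℂ) := by
      rw [← Complex.ofReal_mul, Real.mul_self_sqrt (Nat.cast_nonneg _)]
      simp
    simp only [hw, map_mul, map_pow, Complex.conj_ofReal, mul_pow]
    rw [← hs]
    ring
  have hnorm (i : Fin n) : ∑ l, Complex.normSq (w i l) = 1 := by
    have h := hinner i i
    have haa : starRingEnd ℂ (a i) * a i + starRingEnd ℂ (b i) * b i = 1 := by
      rw [← Complex.normSq_eq_conj_mul_self, ← Complex.normSq_eq_conj_mul_self,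
        ← Complex.ofReal_add]
      norm_cast
      simp [a, b, Complex.normSq_apply]
      linarith [h1 i]
    rw [haa, one_pow] at h
    simp only [← Complex.normSq_eq_conj_mul_self] at h
    exact_mod_cast h
  have hwelch := sq_sum_norm_sq_le_card_mul_sum_norm_inner_sq w
  simp only [hnorm, hinner, map_pow, hab] at hwelch
  rw [div_le_iff₀ (by positivity), mul_comm]
  simpa using hwelch

lemma hasSum_pow_div_factorial_mul_succ {t : ℝ} (ht : t ≠ 0) :
    HasSum (fun k : ℕ => t ^ k / k.factorial * (1 / ((k : ℝ) + 1))) ((exp t - 1) / t) := by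
  have h : HasSum (fun k : ℕ => t ^ k / k.factorial) (exp t) := by
    rw [Real.exp_eq_exp_ℝ]
    exact NormedSpace.expSeries_div_hasSum_exp t
  have h' := ((hasSum_nat_add_iff' 1).2 h).div_const t
  simp only [Finset.sum_range_one, pow_zero, Nat.factorial_zero, Nat.cast_one, div_one] at h'
  refine h'.congr_fun fun k => ?_
  rw [Nat.factorial_succ, pow_succ]
  push_cast
  field_simp

/-- The average of the Gaussian kernel over pairs of points from a configuration on the sphere is
at least its average over the whole sphere. -/
lemma sq_card_mul_le_sum_exp {n : ℕ} (x : Fin n → EuclideanSpace ℝ (Fin 3))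
    (hx : ∀ i, ‖x i‖ = 1) {s : ℝ} (hs : 0 < s) :
    (n : ℝ) ^ 2 * ((1 - exp (-(4 * s))) / (4 * s)) ≤ ∑ i, ∑ j, exp (-(‖x i - x j‖ ^ 2 * s)) := by
  have hexp (t : ℝ) : HasSum (fun k : ℕ => t ^ k / k.factorial) (exp t) := by
    rw [Real.exp_eq_exp_ℝ]
    exact NormedSpace.expSeries_div_hasSum_exp t
  have hleft := (hasSum_pow_div_factorial_mul_succ (t := 4 * s) (by positivity)).mul_left
    ((n : ℝ) ^ 2)
  have hright := hasSum_sum (s := Finset.univ) fun i _ => hasSum_sum (s := Finset.univ) fun j _ =>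
    hexp (4 * s * (1 - ‖x i - x j‖ ^ 2 / 4))
  have hle := hasSum_le (fun k => ?_) hleft hright
  · calc (n : ℝ) ^ 2 * ((1 - exp (-(4 * s))) / (4 * s))
        = exp (-(4 * s)) * ((n : ℝ) ^ 2 * ((exp (4 * s) - 1) / (4 * s))) := by
          have : exp (-(4 * s)) * exp (4 * s) = 1 := by rw [← Real.exp_add]; simp
          linear_combination (-(n : ℝ) ^ 2 / (4 * s)) * this
      _ ≤ exp (-(4 * s)) * ∑ i, ∑ j, exp (4 * s * (1 - ‖x i - x j‖ ^ 2 / 4)) := by gcongr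
      _ = _ := by
          simp_rw [Finset.mul_sum, ← Real.exp_add]
          refine Finset.sum_congr rfl fun i _ => Finset.sum_congr rfl fun j _ => ?_
          congr 1
          ring
  · have h := sq_card_div_le_sum_pow x hx k
    have h0 : 0 ≤ (4 * s) ^ k / k.factorial := by positivity
    calc (n : ℝ) ^ 2 * ((4 * s) ^ k / k.factorial * (1 / ((k : ℝ) + 1)))
        = (4 * s) ^ k / k.factorial * ((n : ℝ) ^ 2 / (k + 1)) := by ring
      _ ≤ (4 * s) ^ k / k.factorial * ∑ i, ∑ j, (1 - ‖x i - x j‖ ^ 2 / 4) ^ k := by gcongr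
      _ = _ := by
          simp_rw [Finset.mul_sum, mul_pow]
          refine Finset.sum_congr rfl fun i _ => Finset.sum_congr rfl fun j _ => ?_
          ring

/-! ### The energy bound -/

lemma continuous_ein_add_einIntegrand_mul_four :
    Continuous fun s => ein (4 * s) + einIntegrand (4 * s) :=
  (continuous_ein.comp (by fun_prop)).add (continuous_einIntegrand.comp (by fun_prop))

/-- The function `s ↦ Ein (4 * s) + (1 - exp (-4 * s)) / (4 * s)` is, up to a constant, the average
over the sphere of `Ein (‖x - y‖ ^ 2 * s)`. -/
lemma hasDerivAt_ein_add_einIntegrand_mul_four {s : ℝ} (hs : 0 < s) :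
    HasDerivAt (fun s => ein (4 * s) + einIntegrand (4 * s))
      ((1 - (1 - exp (-(4 * s))) / (4 * s)) / s) s := by
  have hlin : HasDerivAt (fun s : ℝ => 4 * s) 4 s := by
    simpa using (hasDerivAt_id' s).const_mul (4 : ℝ)
  have hmean : HasDerivAt (fun s => einIntegrand (4 * s))
      ((exp (-(4 * s)) * 4 * (4 * s) - (1 - exp (-(4 * s))) * 4) / (4 * s) ^ 2) s := by
    have h : HasDerivAt (fun s => (1 - exp (-(4 * s))) / (4 * s))
        ((exp (-(4 * s)) * 4 * (4 * s) - (1 - exp (-(4 * s))) * 4) / (4 * s) ^ 2) s := by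
      refine ((hlin.fun_neg.exp.const_sub 1).fun_div hlin (by positivity)).congr_deriv ?_
      ring
    refine h.congr_of_eventuallyEq ?_
    filter_upwards [eventually_gt_nhds hs] with t ht
    exact einIntegrand_of_ne (by positivity)
  refine (((hasDerivAt_ein (4 * s)).comp s hlin).add hmean).congr_deriv ?_
  rw [einIntegrand_of_ne (by positivity)]
  field_simp
  ring

lemma sum_ein_le {n : ℕ} (x : Fin n → EuclideanSpace ℝ (Fin 3)) (hx : ∀ i, ‖x i‖ = 1)
    {S : ℝ} (hS : 0 ≤ S) :
    ∑ i, ∑ j, ein (‖x i - x j‖ ^ 2 * S) ≤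
      (n : ℝ) ^ 2 * (ein (4 * S) + einIntegrand (4 * S) - 1) := by
  set G : ℝ → ℝ := fun s => (n : ℝ) ^ 2 * (ein (4 * s) + einIntegrand (4 * s)) -
    ∑ i, ∑ j, ein (‖x i - x j‖ ^ 2 * s) with hG
  have hterm (u : ℝ) {s : ℝ} (hs : 0 < s) :
      HasDerivAt (fun s => ein (u * s)) ((1 - exp (-(u * s))) / s) s := by
    have hlin : HasDerivAt (fun s : ℝ => u * s) u s := by
      simpa using (hasDerivAt_id' s).const_mul u
    refine ((hasDerivAt_ein (u * s)).comp s hlin).congr_deriv ?_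
    rcases eq_or_ne u 0 with rfl | hu
    · simp
    · rw [einIntegrand_of_ne (by positivity)]
      field_simp
  have hderiv {s : ℝ} (hs : 0 < s) : HasDerivAt G
      ((n : ℝ) ^ 2 * ((1 - (1 - exp (-(4 * s))) / (4 * s)) / s) -
        ∑ i, ∑ j, (1 - exp (-(‖x i - x j‖ ^ 2 * s))) / s) s :=
    ((hasDerivAt_ein_add_einIntegrand_mul_four hs).const_mul _).fun_sub
      (HasDerivAt.fun_sum fun i _ => HasDerivAt.fun_sum fun j _ => hterm _ hs)
  have hcont : Continuous G := by
    refine (continuous_const.mul continuous_ein_add_einIntegrand_mul_four).sub ?_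
    exact continuous_finsetSum _ fun i _ => continuous_finsetSum _ fun j _ =>
      continuous_ein.comp (by fun_prop)
  have hmono : MonotoneOn G (Set.Ici 0) := by
    refine monotoneOn_of_deriv_nonneg (convex_Ici 0) hcont.continuousOn ?_ ?_ <;>
      rw [interior_Ici] <;> intro s (hs : 0 < s)
    · exact (hderiv hs).differentiableAt.differentiableWithinAt
    · have h := sq_card_mul_le_sum_exp x hx hs
      have hsum : ∑ i, ∑ j, (1 - exp (-(‖x i - x j‖ ^ 2 * s))) / s =
          ((n : ℝ) ^ 2 - ∑ i, ∑ j, exp (-(‖x i - x j‖ ^ 2 * s))) / s := by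
        simp [← Finset.sum_div, sq]
      rw [(hderiv hs).deriv, hsum]
      rw [← mul_div_assoc, ← sub_div]
      refine div_nonneg ?_ hs.le
      linarith
  have h := hmono Set.self_mem_Ici hS hS
  simp only [hG, mul_zero, ein_zero, einIntegrand_zero, Finset.sum_const_zero] at h
  linarith

/-- A non-asymptotic lower bound for the logarithmic energy of distinct points on the sphere. -/
lemma le_logEnergy {n : ℕ} (hn : 0 < n) (x : Fin n → EuclideanSpace ℝ (Fin 3))
    (hx : ∀ i, ‖x i‖ = 1) (hinj : Function.Injective x) :
    (1 / 2 - log 2) * (n : ℝ) ^ 2 - n * log n / 2 +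
        n * ((log 4 - 1 - eulerMascheroniConstant) / 2) ≤
      ∑ i : Fin n, ∑ j ∈ Finset.univ \ {i}, log (1 / ‖x i - x j‖) := by
  have hn' : (0 : ℝ) < n := by exact_mod_cast hn
  set S : ℝ := n / 4 with hS
  have hS0 : 0 < S := by positivity
  set c : ℝ := (eulerMascheroniConstant + log S) / 2
  have hpair (i j : Fin n) (hij : j ∈ Finset.univ \ {i}) :
      c - ein (‖x i - x j‖ ^ 2 * S) / 2 ≤ log (1 / ‖x i - x j‖) := by
    have hne : x i ≠ x j := fun h => by simp [hinj h] at hij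
    have hpos : 0 < ‖x i - x j‖ := norm_pos_iff.2 (sub_ne_zero.2 hne)
    have h := eulerMascheroniConstant_add_log_le_ein (z := ‖x i - x j‖ ^ 2 * S) (by positivity)
    rw [log_mul (by positivity) hS0.ne', log_pow] at h
    rw [one_div, log_inv]
    push_cast at h
    simp only [c]
    linarith
  have hrow (i : Fin n) : ∑ j ∈ Finset.univ \ {i}, (c - ein (‖x i - x j‖ ^ 2 * S) / 2) =
      n * c - (∑ j, ein (‖x i - x j‖ ^ 2 * S)) / 2 - c := by
    have h := Finset.sum_sdiff (f := fun j => c - ein (‖x i - x j‖ ^ 2 * S) / 2)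
      (Finset.subset_univ {i})
    simp only [Finset.sum_singleton, sub_self, norm_zero, ne_eq, OfNat.ofNat_ne_zero,
      not_false_eq_true, zero_pow, zero_mul, ein_zero, zero_div, sub_zero] at h
    rw [eq_sub_of_add_eq h]
    simp [Finset.sum_sub_distrib, Finset.sum_div]
  have htotal : (n : ℝ) * (n * c) - (∑ i, ∑ j, ein (‖x i - x j‖ ^ 2 * S)) / 2 - n * c ≤
      ∑ i : Fin n, ∑ j ∈ Finset.univ \ {i}, log (1 / ‖x i - x j‖) := by
    calc _ = ∑ i : Fin n, ∑ j ∈ Finset.univ \ {i}, (c - ein (‖x i - x j‖ ^ 2 * S) / 2) := by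
          simp_rw [hrow]
          simp [Finset.sum_sub_distrib, Finset.sum_div]
      _ ≤ _ := Finset.sum_le_sum fun i _ => Finset.sum_le_sum fun j hj => hpair i j hj
  have hsum := sum_ein_le x hx hS0.le
  have h4S : 4 * S = n := by rw [hS]; ring
  have hein := ein_le_eulerMascheroniConstant_add_log_add hn'
  have hbound : ein n + einIntegrand n - 1 ≤
      eulerMascheroniConstant + log n - 1 + 1 / n := by
    rw [einIntegrand_of_ne hn'.ne', sub_div]
    linarith
  have hlogS : log S = log n - log 4 := log_div hn'.ne' (by norm_num)
  have hlog4 : log 4 = 2 * log 2 := by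
    rw [show (4 : ℝ) = 2 ^ 2 by norm_num, log_pow]
    norm_num
  rw [h4S] at hsum
  have hsum' := hsum.trans (mul_le_mul_of_nonneg_left hbound (sq_nonneg (n : ℝ)))
  have hinv : (n : ℝ) ^ 2 * (1 / n) = n := by field_simp
  refine le_trans ?_ htotal
  simp only [c, hlogS, hlog4] at hsum' ⊢
  nlinarith

lemma exists_injective_unit_vectors (n : ℕ) :
    ∃ x : Fin n → EuclideanSpace ℝ (Fin 3), (∀ i, ‖x i‖ = 1) ∧ Function.Injective x := by
  have hinf : (Metric.sphere (0 : EuclideanSpace ℝ (Fin 3)) 1).Infinite := by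
    refine (isConnected_sphere ?_ 0 zero_le_one).isPreconnected.infinite_of_nontrivial ?_
    · rw [← Module.finrank_eq_rank]
      simp
    · exact (NormedSpace.sphere_nonempty.2 zero_le_one).elim fun v hv =>
        ⟨v, hv, -v, by simpa using hv, fun h => by
          have h2 : (2 : ℝ) • v = 0 := by rw [two_smul, ← eq_neg_iff_add_eq_zero]; exact h
          have : v = 0 := (smul_eq_zero.1 h2).resolve_left two_ne_zero
          simp [this] at hv⟩
  let e := hinf.natEmbedding
  exact ⟨fun i => e i, fun i => by simp, fun i j h =>
    Fin.ext (e.injective (Subtype.ext h))⟩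

lemma le_minLogEnergy {n : ℕ} (hn : 0 < n) :
    (1 / 2 - log 2) * (n : ℝ) ^ 2 - n * log n / 2 +
      n * ((log 4 - 1 - eulerMascheroniConstant) / 2) ≤ minLogEnergy n := by
  obtain ⟨x, hx, hinj⟩ := exists_injective_unit_vectors n
  refine le_csInf ⟨_, x, hx, hinj, rfl⟩ ?_
  rintro E ⟨y, hy, hyinj, rfl⟩
  exact le_logEnergy hn y hy hyinj

theorem clog_lower_bound :
    (Real.log 4 - 1 - Real.eulerMascheroniConstant) / 2 ≤
      Filter.atTop.liminf (fun n : ℕ =>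
        (minLogEnergy n - (1 / 2 - Real.log 2) * (n : ℝ) ^ 2
          + (n : ℝ) * Real.log n / 2) / (n : ℝ)) := by
  have hev : ∀ᶠ n : ℕ in atTop, (log 4 - 1 - eulerMascheroniConstant) / 2 ≤
      (minLogEnergy n - (1 / 2 - log 2) * (n : ℝ) ^ 2 + (n : ℝ) * log n / 2) / (n : ℝ) := by
    filter_upwards [eventually_gt_atTop 0] with n hn
    rw [le_div_iff₀ (by exact_mod_cast hn)]
    linarith [le_minLogEnergy hn]
  rw [Filter.liminf_eq]
  by_cases hbdd : BddAbove {a : ℝ | ∀ᶠ n : ℕ in atTop, a ≤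
      (minLogEnergy n - (1 / 2 - log 2) * (n : ℝ) ^ 2 + (n : ℝ) * log n / 2) / (n : ℝ)}
  · exact le_csSup hbdd hev
  · rw [Real.sSup_of_not_bddAbove hbdd]
    have hlog4 : log 4 = 2 * log 2 := by
      rw [show (4 : ℝ) = 2 ^ 2 by norm_num, log_pow]
      norm_num
    linarith [log_two_lt_d9, one_half_lt_eulerMascheroniConstant]
end

section
/- Let s > 0 and for each n let x₁⁽ⁿ⁾,…,xₙ⁽ⁿ⁾ be any n pairwise distinct points on the unit sphere S² ⊂ ℝ³. Let N(n) be the number of indices i ∈ {1,…,n} such that there exists j ≠ i with ‖x_i⁽ⁿ⁾ − x_j⁽ⁿ⁾‖ ≤ s/√n. Then liminf_{n→∞} N(n)/n ≥ 1 − (4/s²)·(2π/√3); that is, N(n) ≥ (1 − 8π/(√3·s²))·n + o(n) as n → ∞. -/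
open MeasureTheory Real Filter Finset

theorem mul_le_sin_mul_cos {a : ℝ} (h0 : 0 ≤ a) (h1 : a ≤ π / 6) :
    3 * √3 / (2 * π) * a ≤ sin a * cos a := by
  have hpi := pi_pos
  have key := strictConcaveOn_sin_Icc.concaveOn.2
    (show (0 : ℝ) ∈ Set.Icc 0 π by constructor <;> linarith)
    (show π / 3 ∈ Set.Icc 0 π by constructor <;> linarith)
    (show 0 ≤ 1 - 6 * a / π by rw [sub_nonneg, div_le_one hpi]; linarith)
    (show 0 ≤ 6 * a / π by positivity) (by ring)
  have e : (1 - 6 * a / π) • (0 : ℝ) + (6 * a / π) • (π / 3) = 2 * a := by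
    simp only [smul_eq_mul]; field_simp; ring
  rw [e, sin_two_mul, sin_pi_div_three] at key
  simp only [smul_eq_mul, sin_zero] at key
  have e2 : 3 * √3 / (2 * π) * a = (6 * a / π * (√3 / 2)) / 2 := by field_simp; ring
  linarith

/-- The open unit disc sector of half-angle `a` around the positive real axis has area `a`. -/
theorem volume_sector {a : ℝ} (h0 : 0 < a) (h1 : a ≤ π / 6) :
    volume {z : ℂ | ‖z‖ < 1 ∧ ‖z‖ * cos a < z.re} = ENNReal.ofReal a := by
  have hpi := pi_pos
  have hm : MeasurableSet {z : ℂ | ‖z‖ < 1 ∧ ‖z‖ * cos a < z.re} := by measurability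
  rw [← lintegral_indicator_one hm, ← Complex.lintegral_comp_polarCoord_symm]
  have : ∀ p ∈ polarCoord.target, ENNReal.ofReal p.1 •
      ({z : ℂ | ‖z‖ < 1 ∧ ‖z‖ * cos a < z.re}.indicator (1 : ℂ → ENNReal)
        (Complex.polarCoord.symm p)) =
      (Set.Ioo 0 1 ×ˢ Set.Ioo (-a) a).indicator (fun p : ℝ × ℝ => ENNReal.ofReal p.1 * 1) p := by
    rintro ⟨r, t⟩ ⟨hr, ht⟩
    simp only [Set.mem_Ioi, Set.mem_Ioo] at hr ht
    have hn : ‖Complex.polarCoord.symm (r, t)‖ = r := by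
      rw [Complex.norm_polarCoord_symm, abs_of_pos hr]
    have hre : (Complex.polarCoord.symm (r, t)).re = r * cos t := by
      simp [Complex.polarCoord_symm_apply, Complex.cos_ofReal_re]
    have hiff : (Complex.polarCoord.symm (r, t)) ∈ {z : ℂ | ‖z‖ < 1 ∧ ‖z‖ * cos a < z.re} ↔
        (r, t) ∈ Set.Ioo (0 : ℝ) 1 ×ˢ Set.Ioo (-a) a := by
      simp only [Set.mem_ofPred_eq, Set.mem_prod, Set.mem_Ioo, hn, hre, hr, true_and,
        mul_lt_mul_iff_right₀ hr, ← abs_lt]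
      rw [← cos_abs t]
      have ht' : |t| ≤ π := abs_le.2 ⟨ht.1.le, ht.2.le⟩
      rw [strictAntiOn_cos.lt_iff_gt (a := a) (b := |t|) ⟨h0.le, by linarith⟩ ⟨abs_nonneg _, ht'⟩]
    by_cases h : (r, t) ∈ Set.Ioo (0 : ℝ) 1 ×ˢ Set.Ioo (-a) a
    · rw [Set.indicator_of_mem h, Set.indicator_of_mem (hiff.2 h)]; simp
    · rw [Set.indicator_of_notMem h, Set.indicator_of_notMem (fun h' => h (hiff.1 h'))]; simp
  rw [setLIntegral_congr_fun polarCoord.open_target.measurableSet this,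
    lintegral_indicator (measurableSet_Ioo.prod measurableSet_Ioo), Measure.restrict_restrict
    (measurableSet_Ioo.prod measurableSet_Ioo)]
  have hsub : Set.Ioo (0 : ℝ) 1 ×ˢ Set.Ioo (-a) a ∩ polarCoord.target =
      Set.Ioo (0 : ℝ) 1 ×ˢ Set.Ioo (-a) a := by
    rw [Set.inter_eq_left, polarCoord_target]
    refine Set.prod_mono (fun _ h => h.1) (Set.Ioo_subset_Ioo ?_ ?_) <;> linarith
  rw [hsub, Measure.volume_eq_prod, ← Measure.prod_restrict,
    lintegral_prod_mul (f := fun r => ENNReal.ofReal r) (g := fun _ => 1) (by fun_prop) (by fun_prop)]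
  have hI : ∫⁻ r in Set.Ioo (0 : ℝ) 1, ENNReal.ofReal r = ENNReal.ofReal (1 / 2) := by
    rw [← ofReal_integral_eq_lintegral_ofReal]
    · rw [← integral_Ioc_eq_integral_Ioo, ← intervalIntegral.integral_of_le zero_le_one]
      simp
    · exact (continuous_id.integrableOn_Icc (a := (0 : ℝ)) (b := 1)).mono_set
        Set.Ioo_subset_Icc_self
    · filter_upwards [ae_restrict_mem measurableSet_Ioo] with r hr using hr.1.le
  rw [hI, lintegral_one, Measure.restrict_apply_univ, Real.volume_Ioo,
    ← ENNReal.ofReal_mul (by norm_num)]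
  congr 1; ring

/-- The open triangle spanned by the origin and the endpoints of the arc of half-angle `a`. -/
theorem volume_triangle_ge {a : ℝ} (h0 : 0 < a) (h1 : a ≤ π / 6) :
    ENNReal.ofReal (sin a * cos a) ≤ volume {z : ℂ | ‖z‖ * cos a < z.re ∧ z.re < cos a} := by
  have hpi := pi_pos
  have hc : 0 < cos a := cos_pos_of_mem_Ioo ⟨by linarith, by linarith⟩
  have hs : 0 < sin a := sin_pos_of_pos_of_lt_pi h0 (by linarith)
  have ht : 0 < tan a := by rw [tan_eq_sin_div_cos]; positivity
  set D := regionBetween (fun x : ℝ => -(tan a * x)) (fun x => tan a * x) (Set.Ioo 0 (cos a))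
  have hD : volume D = ENNReal.ofReal (sin a * cos a) := by
    rw [Measure.volume_eq_prod, volume_regionBetween_eq_integral]
    · congr 1
      rw [← integral_Ioc_eq_integral_Ioo, ← intervalIntegral.integral_of_le hc.le]
      have : ∀ x : ℝ, ((fun x => tan a * x) - fun x => -(tan a * x)) x = (2 * tan a) * x := by
        intro x; simp; ring
      simp only [this]
      rw [intervalIntegral.integral_const_mul, integral_id, tan_eq_sin_div_cos]
      field_simp; ring
    · exact (Continuous.integrableOn_Icc (a := (0 : ℝ)) (b := cos a) (by fun_prop)).mono_set
        Set.Ioo_subset_Icc_self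
    · exact (Continuous.integrableOn_Icc (a := (0 : ℝ)) (b := cos a) (by fun_prop)).mono_set
        Set.Ioo_subset_Icc_self
    · exact measurableSet_Ioo
    · intro x hx
      have := mul_pos ht hx.1
      linarith
  rw [← hD, ← Complex.volume_preserving_equiv_real_prod.measure_preimage_equiv]
  refine measure_mono ?_
  rintro z ⟨⟨hz0, hz1⟩, hz2, hz3⟩
  simp only [Complex.measurableEquivRealProd_apply] at hz0 hz1 hz2 hz3
  refine ⟨?_, hz1⟩
  have hi : |z.im| < tan a * z.re := abs_lt.2 ⟨by linarith, hz3⟩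
  have hi2 : z.im ^ 2 < (tan a * z.re) ^ 2 := by
    rw [← sq_abs z.im]; exact pow_lt_pow_left₀ hi (abs_nonneg _) two_ne_zero
  refine lt_of_pow_lt_pow_left₀ 2 hz0.le ?_
  rw [mul_pow, Complex.sq_norm, Complex.normSq_apply]
  have : (tan a) ^ 2 * cos a ^ 2 = 1 - cos a ^ 2 := by
    rw [tan_eq_sin_div_cos, div_pow, div_mul_cancel₀ _ (by positivity)]
    linarith [sin_sq_add_cos_sq a]
  have h4 : z.im ^ 2 * cos a ^ 2 < (tan a * z.re) ^ 2 * cos a ^ 2 := by gcongr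
  nlinarith

/-- The part of the open unit disc that is at least as close to `q` as to the centre. -/
def discSegment (q : ℂ) : Set ℂ := {z | ‖z‖ < 1 ∧ ‖z - q‖ ≤ ‖z‖}

/-- The sector of the open unit disc spanned by `discSegment q`. -/
def discSector (q : ℂ) : Set ℂ :=
  {z | ‖z‖ < 1 ∧ ‖z - q‖ ^ 2 < ‖z‖ ^ 2 + ‖q‖ ^ 2 - ‖z‖ * ‖q‖ ^ 2}

theorem measurableSet_discSegment (q : ℂ) : MeasurableSet (discSegment q) := by
  unfold discSegment
  measurability

theorem measurableSet_discSector (q : ℂ) : MeasurableSet (discSector q) := by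
  unfold discSector
  measurability

theorem discSegment_eq_empty {q : ℂ} (hq : 2 ≤ ‖q‖) : discSegment q = ∅ := by
  refine Set.eq_empty_of_forall_notMem ?_
  rintro z ⟨h1, h2⟩
  have := norm_sub_le z (z - q)
  rw [sub_sub_cancel] at this
  linarith

theorem volume_disc : (volume : Measure ℂ).real (Metric.ball 0 1) = π := by
  simp [Measure.real, Complex.volume_ball]

theorem discSector_subset (q : ℂ) : discSector q ⊆ Metric.ball 0 1 :=
  fun z hz => by simpa using hz.1

theorem discSegment_subset (q : ℂ) : discSegment q ⊆ Metric.ball 0 1 :=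
  fun z hz => by simpa using hz.1

theorem volume_ne_top_of_subset_disc {s : Set ℂ} (h : s ⊆ Metric.ball 0 1) : volume s ≠ ⊤ :=
  measure_ne_top_of_subset h measure_ball_lt_top.ne

theorem norm_sub_ofReal_sq (z : ℂ) (r : ℝ) :
    ‖z - r‖ ^ 2 = ‖z‖ ^ 2 - 2 * r * z.re + r ^ 2 := by
  simp only [Complex.sq_norm, Complex.normSq_apply, Complex.sub_re, Complex.sub_im,
    Complex.ofReal_re, Complex.ofReal_im]
  ring

theorem volume_discSegment_le_of_pos {r : ℝ} (h1 : √3 ≤ r) (h2 : r < 2) :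
    volume.real (discSegment r) ≤
      (1 - 3 * √3 / (2 * π)) * volume.real (discSector (r : ℂ)) := by
  have hpi := pi_pos
  have h3 : 0 < √3 := by positivity
  have hr : 0 < r := by linarith
  set a := arccos (r / 2) with ha
  have hcos : cos a = r / 2 := cos_arccos (by linarith) (by linarith)
  have ha0 : 0 < a := arccos_pos.2 (by linarith)
  have ha1 : a ≤ π / 6 := by
    rw [← arccos_cos (x := π / 6) (by positivity) (by linarith), cos_pi_div_six]
    exact arccos_le_arccos (by linarith)
  have hnr : ‖(r : ℂ)‖ = r := by simp [abs_of_pos hr]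
  have hsec : discSector (r : ℂ) = {z : ℂ | ‖z‖ < 1 ∧ ‖z‖ * cos a < z.re} := by
    ext z
    simp only [discSector, Set.mem_ofPred_eq, norm_sub_ofReal_sq, hnr, hcos]
    refine and_congr_right fun _ => ⟨fun h => ?_, fun h => ?_⟩
    · refine lt_of_mul_lt_mul_left ?_ hr.le
      nlinarith
    · nlinarith
  have htri : {z : ℂ | ‖z‖ * cos a < z.re ∧ z.re < cos a} ⊆ discSector (r : ℂ) \ discSegment r := by
    rintro z ⟨hz1, hz2⟩
    have hc : 0 < cos a := by rw [hcos]; linarith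
    refine ⟨hsec ▸ ⟨?_, hz1⟩, fun h => ?_⟩
    · by_contra! h
      nlinarith
    · have := pow_le_pow_left₀ (norm_nonneg _) h.2 2
      rw [norm_sub_ofReal_sq] at this
      rw [hcos] at hz2
      nlinarith
  have hsub : discSegment (r : ℂ) ⊆ discSector r := by
    rintro z ⟨hz1, hz2⟩
    refine ⟨hz1, ?_⟩
    have := pow_le_pow_left₀ (norm_nonneg _) hz2 2
    rw [hnr]
    have := mul_pos (sub_pos.2 hz1) (pow_pos hr 2)
    nlinarith
  have hvs : volume.real (discSector (r : ℂ)) = a := by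
    rw [hsec, Measure.real, volume_sector ha0 ha1, ENNReal.toReal_ofReal ha0.le]
  have hvt : sin a * cos a ≤ volume.real (discSector (r : ℂ) \ discSegment r) := by
    refine (ENNReal.ofReal_le_iff_le_toReal ?_).1
      ((volume_triangle_ge ha0 ha1).trans (measure_mono htri))
    exact volume_ne_top_of_subset_disc (Set.sdiff_subset.trans (discSector_subset _))
  rw [measureReal_sdiff hsub (measurableSet_discSegment _)
    (volume_ne_top_of_subset_disc (discSector_subset _)), hvs] at hvt
  rw [hvs]
  linarith [mul_le_sin_mul_cos ha0.le ha1]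

theorem one_sub_hexagon_density_nonneg : 0 ≤ 1 - 3 * √3 / (2 * π) := by
  have : √3 ≤ 2 := by rw [Real.sqrt_le_left (by norm_num)]; norm_num
  rw [sub_nonneg, div_le_one (by positivity)]
  linarith [pi_gt_three]

theorem volume_discSegment_le {q : ℂ} (hq : √3 ≤ ‖q‖) :
    volume.real (discSegment q) ≤
      (1 - 3 * √3 / (2 * π)) * volume.real (discSector q) := by
  have h3 : 0 < √3 := by positivity
  have hc := one_sub_hexagon_density_nonneg
  rcases le_or_gt 2 ‖q‖ with h | h
  · rw [discSegment_eq_empty h]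
    simp only [measureReal_empty]
    positivity
  have hq0 : (‖q‖ : ℂ) ≠ 0 := by
    have : ‖q‖ ≠ 0 := by linarith
    exact_mod_cast this
  set u : Circle := ⟨q / ‖q‖, by
    refine mem_sphere_zero_iff_norm.2 ?_
    rw [norm_div, Complex.norm_real, norm_norm, div_self (by linarith)]⟩ with hu
  have huq : rotation u ‖q‖ = q := by
    rw [rotation_apply]
    simp only [hu]
    field_simp
  have e1 : rotation u ⁻¹' discSegment q = discSegment (‖q‖ : ℂ) := by
    ext z
    nth_rewrite 1 [← huq]
    simp only [discSegment, Set.mem_preimage, Set.mem_ofPred_eq, ← map_sub,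
      LinearIsometryEquiv.norm_map]
  have e2 : rotation u ⁻¹' discSector q = discSector (‖q‖ : ℂ) := by
    ext z
    nth_rewrite 1 [← huq]
    simp only [discSector, Set.mem_preimage, Set.mem_ofPred_eq, ← map_sub,
      LinearIsometryEquiv.norm_map]
  have mp := (rotation u).measurePreserving
  have := volume_discSegment_le_of_pos hq h
  rwa [← e1, ← e2, mp.measureReal_preimage (measurableSet_discSegment _).nullMeasurableSet,
    mp.measureReal_preimage (measurableSet_discSector _).nullMeasurableSet] at this

theorem disjoint_discSector {p q : ℂ} (hp : √3 ≤ ‖p‖) (hq : √3 ≤ ‖q‖) (hpq : √3 ≤ ‖p - q‖) :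
    Disjoint (discSector p) (discSector q) := by
  rw [Set.disjoint_left]
  rintro z ⟨-, h1⟩ ⟨-, h2⟩
  have sq3 : ∀ {w : ℂ}, √3 ≤ ‖w‖ → 3 ≤ ‖w‖ ^ 2 := fun h => by
    have := pow_le_pow_left₀ (by positivity) h 2
    rwa [Real.sq_sqrt (by norm_num)] at this
  have hz : 0 < ‖z‖ := by
    rw [norm_pos_iff]
    rintro rfl
    simp at h1
  have a1 := sq3 hp
  have a2 := sq3 hq
  have a3 := sq3 hpq
  have hpos : 0 ≤ ‖‖z‖ • (p + q) - (3 : ℝ) • z‖ ^ 2 := sq_nonneg _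
  have expand : ‖‖z‖ • (p + q) - (3 : ℝ) • z‖ ^ 2 =
      ‖z‖ ^ 2 * (2 * ‖p‖ ^ 2 + 2 * ‖q‖ ^ 2 - ‖p - q‖ ^ 2) + 9 * ‖z‖ ^ 2
      - 3 * ‖z‖ * (‖z‖ ^ 2 + ‖p‖ ^ 2 - ‖z - p‖ ^ 2)
      - 3 * ‖z‖ * (‖z‖ ^ 2 + ‖q‖ ^ 2 - ‖z - q‖ ^ 2) := by
    have hzz : ‖z‖ ^ 2 = z.re * z.re + z.im * z.im := by rw [Complex.sq_norm, Complex.normSq_apply]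
    generalize ‖z‖ = t at *
    simp only [Complex.sq_norm, Complex.normSq_apply, Complex.sub_re, Complex.sub_im,
      Complex.add_re, Complex.add_im, Complex.smul_re, Complex.smul_im, smul_eq_mul]
    linear_combination (6 * t - 9) * hzz
  have b1 := mul_lt_mul_of_pos_left h1 hz
  have b2 := mul_lt_mul_of_pos_left h2 hz
  have c := mul_le_mul_of_nonneg_left (add_le_add (add_le_add a1 a2) a3) (sq_nonneg ‖z‖)
  nlinarith

/-- The Voronoi cell of the origin with respect to `Q`, truncated to the unit disc. -/
def truncatedCell (Q : Finset ℂ) : Set ℂ := {z | ‖z‖ < 1 ∧ ∀ q ∈ Q, ‖z‖ < ‖z - q‖}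

theorem measurableSet_truncatedCell (Q : Finset ℂ) : MeasurableSet (truncatedCell Q) := by
  have : truncatedCell Q = Metric.ball 0 1 ∩ ⋂ q ∈ Q, {z : ℂ | ‖z‖ < ‖z - q‖} := by
    ext z; simp [truncatedCell]
  rw [this]
  exact measurableSet_ball.inter (Q.measurableSet_biInter fun q _ =>
    measurableSet_lt (by fun_prop) (by fun_prop))

theorem volume_truncatedCell_ge {Q : Finset ℂ} (hQ : ∀ q ∈ Q, √3 ≤ ‖q‖)
    (hQQ : ∀ p ∈ Q, ∀ q ∈ Q, p ≠ q → √3 ≤ ‖p - q‖) :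
    3 * √3 / 2 ≤ volume.real (truncatedCell Q) := by
  have hpi := pi_pos
  have h3 : 0 < √3 := by positivity
  have hc := one_sub_hexagon_density_nonneg
  have hcover : Metric.ball (0 : ℂ) 1 ⊆ truncatedCell Q ∪ ⋃ q ∈ Q, discSegment q := by
    intro z hz
    have hz' : ‖z‖ < 1 := by simpa using hz
    by_cases h : ∀ q ∈ Q, ‖z‖ < ‖z - q‖
    · exact Or.inl ⟨hz', h⟩
    · push Not at h
      obtain ⟨q, hq, hle⟩ := h
      exact Or.inr (Set.mem_biUnion hq ⟨hz', hle⟩)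
  have hcell : truncatedCell Q ⊆ Metric.ball 0 1 := fun z hz => by simpa using hz.1
  have hseg : (⋃ q ∈ Q, discSegment q) ⊆ Metric.ball 0 1 :=
    Set.iUnion₂_subset fun q _ => discSegment_subset q
  have hsec : (⋃ q ∈ Q, discSector q) ⊆ Metric.ball 0 1 :=
    Set.iUnion₂_subset fun q _ => discSector_subset q
  have s1 : π ≤ volume.real (truncatedCell Q) + ∑ q ∈ Q, volume.real (discSegment q) := by
    rw [← volume_disc]
    refine (measureReal_mono hcover
      (volume_ne_top_of_subset_disc (Set.union_subset hcell hseg))).trans ?_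
    refine (measureReal_union_le _ _).trans ?_
    gcongr
    exact measureReal_biUnion_finset_le _ _
  have s2 : ∑ q ∈ Q, volume.real (discSector q) ≤ π := by
    rw [← measureReal_biUnion_finset
      (fun p hp q hq hne => disjoint_discSector (hQ p hp) (hQ q hq) (hQQ p hp q hq hne))
      (fun q _ => measurableSet_discSector q)
      (fun q _ => volume_ne_top_of_subset_disc (discSector_subset q)), ← volume_disc]
    exact measureReal_mono hsec measure_ball_lt_top.ne
  have s3 : ∑ q ∈ Q, volume.real (discSegment q) ≤
      (1 - 3 * √3 / (2 * π)) * ∑ q ∈ Q, volume.real (discSector q) := by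
    rw [Finset.mul_sum]
    exact Finset.sum_le_sum fun q hq => volume_discSegment_le (hQ q hq)
  have s4 := mul_le_mul_of_nonneg_left s2 hc
  have e : (1 - 3 * √3 / (2 * π)) * π = π - 3 * √3 / 2 := by field_simp
  linarith

/-- **Thue's theorem** in finite form: points at mutual distance at least `√3` whose unit discs lie
in `A` number at most `area A / (3√3/2)`. -/
theorem card_mul_le_volume {P : Finset ℂ} (hP : ∀ p ∈ P, ∀ q ∈ P, p ≠ q → √3 ≤ ‖p - q‖)
    {A : Set ℂ} (hA : volume A ≠ ⊤) (hPA : ∀ p ∈ P, Metric.ball p 1 ⊆ A) :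
    (#P : ℝ) * (3 * √3 / 2) ≤ volume.real A := by
  let N : ℂ → Finset ℂ := fun p => (P.erase p).image (· - p)
  let cell : ℂ → Set ℂ := fun p => (· - p) ⁻¹' truncatedCell (N p)
  have hcell : ∀ {p z : ℂ}, z ∈ cell p ↔ ‖z - p‖ < 1 ∧ ∀ q ∈ P, q ≠ p → ‖z - p‖ < ‖z - q‖ := by
    intro p z
    simp only [cell, N, Set.mem_preimage, truncatedCell, Set.mem_ofPred_eq, Finset.forall_mem_image,
      Finset.mem_erase, sub_sub_sub_cancel_right, and_imp]
    exact and_congr_right fun _ => forall_congr' fun q => forall_comm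
  have hmeas : ∀ p, MeasurableSet (cell p) := fun p =>
    (measurable_id.sub_const p) (measurableSet_truncatedCell _)
  have hsub : ∀ p ∈ P, cell p ⊆ A := fun p hp z hz =>
    hPA p hp (by rw [Metric.mem_ball, dist_eq_norm]; exact (hcell.1 hz).1)
  have hvol : ∀ p ∈ P, 3 * √3 / 2 ≤ volume.real (cell p) := by
    intro p hp
    rw [(measurePreserving_sub_right volume p).measureReal_preimage
      (measurableSet_truncatedCell _).nullMeasurableSet]
    apply volume_truncatedCell_ge
    · simp only [N, Finset.forall_mem_image, Finset.mem_erase]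
      exact fun q hq => hP q hq.2 p hp hq.1
    · simp only [N, Finset.forall_mem_image, Finset.mem_erase]
      intro q hq r hr hne
      rw [sub_sub_sub_cancel_right]
      exact hP q hq.2 r hr.2 (fun h => hne (by rw [h]))
  have hdisj : (P : Set ℂ).PairwiseDisjoint cell := by
    intro p hp q hq hne
    refine Set.disjoint_left.2 fun z h1 h2 => ?_
    exact lt_asymm ((hcell.1 h1).2 q hq hne.symm) ((hcell.1 h2).2 p hp hne)
  calc (#P : ℝ) * (3 * √3 / 2) = ∑ p ∈ P, 3 * √3 / 2 := by simp
    _ ≤ ∑ p ∈ P, volume.real (cell p) := Finset.sum_le_sum hvol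
    _ = volume.real (⋃ p ∈ P, cell p) :=
      (measureReal_biUnion_finset hdisj (fun p _ => hmeas p)
        (fun p hp => measure_ne_top_of_subset (hsub p hp) hA)).symm
    _ ≤ volume.real A := measureReal_mono (Set.iUnion₂_subset hsub) hA

theorem volume_rectangle (a b c d : ℝ) :
    volume {z : ℂ | z.re ∈ Set.Icc a b ∧ z.im ∈ Set.Icc c d} =
      ENNReal.ofReal (b - a) * ENNReal.ofReal (d - c) := by
  rw [← Real.volume_Icc, ← Real.volume_Icc, ← Measure.prod_prod, ← Measure.volume_eq_prod,
    ← Complex.volume_preserving_equiv_real_prod.measure_preimage_equiv]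
  rfl

theorem card_le_of_separated_in_rectangle {ι : Type*} {P : Finset ι} {f : ι → ℂ} {a b w h d : ℝ}
    (hd : 0 < d) (hw : 0 ≤ w) (hh : 0 ≤ h)
    (hf : ∀ i ∈ P, ∀ j ∈ P, i ≠ j → d ≤ ‖f i - f j‖)
    (hre : ∀ i ∈ P, (f i).re ∈ Set.Icc a (a + w)) (him : ∀ i ∈ P, (f i).im ∈ Set.Icc b (b + h)) :
    (#P : ℝ) * (√3 / 2 * d ^ 2) ≤ (w + 2 * d / √3) * (h + 2 * d / √3) := by
  have h3 : 0 < √3 := by positivity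
  have hs3 : √3 ^ 2 = 3 := Real.sq_sqrt (by norm_num)
  set k : ℝ := √3 / d with hk
  have hk0 : 0 < k := by positivity
  have hkd : k * d = √3 := by rw [hk]; field_simp
  have hnorm : ∀ i ∈ P, ∀ j ∈ P, i ≠ j → √3 ≤ ‖(k : ℂ) * f i - k * f j‖ := by
    intro i hi j hj hij
    rw [← mul_sub, norm_mul, Complex.norm_real, Real.norm_of_nonneg hk0.le, ← hkd]
    exact mul_le_mul_of_nonneg_left (hf i hi j hj hij) hk0.le
  have hinj : Set.InjOn (fun i => (k : ℂ) * f i) P := by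
    intro i hi j hj hij
    by_contra hne
    have := hnorm i hi j hj hne
    simp only at hij
    rw [hij, sub_self, norm_zero] at this
    linarith
  have hvol := volume_rectangle (k * a - 1) (k * (a + w) + 1) (k * b - 1) (k * (b + h) + 1)
  have key := card_mul_le_volume (P := P.image fun i => (k : ℂ) * f i)
    (A := {z : ℂ | z.re ∈ Set.Icc (k * a - 1) (k * (a + w) + 1) ∧
      z.im ∈ Set.Icc (k * b - 1) (k * (b + h) + 1)}) ?_ ?_ ?_
  · rw [Finset.card_image_of_injOn hinj, Measure.real, hvol, ENNReal.toReal_mul,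
      ENNReal.toReal_ofReal (by nlinarith), ENNReal.toReal_ofReal (by nlinarith)] at key
    have e1 : w + 2 * d / √3 = (k * (a + w) + 1 - (k * a - 1)) * (d / √3) := by
      rw [hk]; field_simp; ring
    have e2 : h + 2 * d / √3 = (k * (b + h) + 1 - (k * b - 1)) * (d / √3) := by
      rw [hk]; field_simp; ring
    have e3 : √3 / 2 * d ^ 2 = 3 * √3 / 2 * (d / √3) ^ 2 := by
      rw [div_pow, hs3]; ring
    rw [e1, e2, e3]
    have := mul_le_mul_of_nonneg_right key (sq_nonneg (d / √3))
    linarith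
  · simp only [Finset.forall_mem_image]
    exact fun i hi j hj hne => hnorm i hi j hj (fun h => hne (by rw [h]))
  · rw [hvol]
    exact ENNReal.mul_ne_top ENNReal.ofReal_ne_top ENNReal.ofReal_ne_top
  · simp only [Finset.forall_mem_image]
    intro i hi z hz
    rw [Metric.mem_ball, dist_eq_norm] at hz
    have r1 := abs_le.1 ((Complex.abs_re_le_norm _).trans hz.le)
    have r2 := abs_le.1 ((Complex.abs_im_le_norm _).trans hz.le)
    simp only [Complex.sub_re, Complex.sub_im, Complex.re_ofReal_mul, Complex.im_ofReal_mul] at r1 r2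
    have b1 := mul_le_mul_of_nonneg_left (hre i hi).1 hk0.le
    have b2 := mul_le_mul_of_nonneg_left (hre i hi).2 hk0.le
    have b3 := mul_le_mul_of_nonneg_left (him i hi).1 hk0.le
    have b4 := mul_le_mul_of_nonneg_left (him i hi).2 hk0.le
    exact ⟨⟨by linarith, by linarith⟩, ⟨by linarith, by linarith⟩⟩

/-- Longitude of a point of the sphere. -/
noncomputable def longitude (x : EuclideanSpace ℝ (Fin 3)) : ℝ := Complex.arg ⟨x 0, x 1⟩

/-- Latitude of a point of the sphere. -/
noncomputable def latitude (x : EuclideanSpace ℝ (Fin 3)) : ℝ := arcsin (x 2)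

theorem spherical_coordinates {x : EuclideanSpace ℝ (Fin 3)} (hx : ‖x‖ = 1) :
    x 0 = cos (latitude x) * cos (longitude x) ∧ x 1 = cos (latitude x) * sin (longitude x) ∧
      x 2 = sin (latitude x) := by
  have hsum : x 0 ^ 2 + x 1 ^ 2 + x 2 ^ 2 = 1 := by
    have := EuclideanSpace.norm_sq_eq x
    rw [hx, Fin.sum_univ_three] at this
    simp only [Real.norm_eq_abs, sq_abs] at this
    linarith
  have hz : ‖(⟨x 0, x 1⟩ : ℂ)‖ = cos (latitude x) := by
    rw [latitude, cos_arcsin, Complex.norm_def, Complex.normSq_mk]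
    congr 1
    linarith
  refine ⟨?_, ?_, ?_⟩
  · rw [← hz, longitude, Complex.norm_mul_cos_arg]
  · rw [← hz, longitude, Complex.norm_mul_sin_arg]
  · rw [latitude, sin_arcsin] <;> nlinarith [sq_nonneg (x 0), sq_nonneg (x 1)]

theorem norm_sub_sq_le {x y : EuclideanSpace ℝ (Fin 3)} (hx : ‖x‖ = 1) (hy : ‖y‖ = 1) {r : ℝ}
    (hxr : cos (latitude x) ≤ r) (hyr : cos (latitude y) ≤ r) :
    ‖x - y‖ ^ 2 ≤ (r * longitude x - r * longitude y) ^ 2 + (latitude x - latitude y) ^ 2 := by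
  obtain ⟨x0, x1, x2⟩ := spherical_coordinates hx
  obtain ⟨y0, y1, y2⟩ := spherical_coordinates hy
  have cx : 0 ≤ cos (latitude x) := cos_arcsin_nonneg _
  have cy : 0 ≤ cos (latitude y) := cos_arcsin_nonneg _
  rw [EuclideanSpace.norm_sq_eq, Fin.sum_univ_three]
  simp only [Real.norm_eq_abs, sq_abs, PiLp.sub_apply, x0, x1, x2, y0, y1, y2]
  generalize latitude x = u at *
  generalize latitude y = v at *
  generalize longitude x = s at *
  generalize longitude y = t at *
  have h1 := one_sub_sq_div_two_le_cos (x := u - v)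
  have h2 := one_sub_sq_div_two_le_cos (x := s - t)
  have h3 : cos u * cos v ≤ r ^ 2 := by rw [sq]; gcongr; linarith
  have h4 : cos u * cos v * (2 * (1 - cos (s - t))) ≤ r ^ 2 * (s - t) ^ 2 := by
    gcongr
    · linarith [cos_le_one (s - t)]
    · linarith
  have e : (cos u * cos s - cos v * cos t) ^ 2 + (cos u * sin s - cos v * sin t) ^ 2
      + (sin u - sin v) ^ 2 = 2 * (1 - cos (u - v)) + cos u * cos v * (2 * (1 - cos (s - t))) := by
    rw [cos_sub, cos_sub]
    linear_combination (cos u ^ 2) * sin_sq_add_cos_sq s + (cos v ^ 2) * sin_sq_add_cos_sq t +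
      sin_sq_add_cos_sq u + sin_sq_add_cos_sq v
  rw [e]
  nlinarith

theorem card_le_of_separated_in_strip {ι : Type*} {P : Finset ι}
    {x : ι → EuclideanSpace ℝ (Fin 3)} (hx : ∀ i ∈ P, ‖x i‖ = 1) {d b h r : ℝ} (hd : 0 < d)
    (hh : 0 ≤ h) (hr : 0 ≤ r) (hP : ∀ i ∈ P, ∀ j ∈ P, i ≠ j → d ≤ ‖x i - x j‖)
    (hlat : ∀ i ∈ P, latitude (x i) ∈ Set.Icc b (b + h))
    (hcos : ∀ i ∈ P, cos (latitude (x i)) ≤ r) :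
    (#P : ℝ) * (√3 / 2 * d ^ 2) ≤ (2 * π * r + 2 * d / √3) * (h + 2 * d / √3) := by
  have hpi := pi_pos
  refine card_le_of_separated_in_rectangle (a := -π * r) (b := b)
    (f := fun i => ⟨r * longitude (x i), latitude (x i)⟩) hd (by positivity) hh ?_ ?_ hlat
  · intro i hi j hj hij
    refine (hP i hi j hj hij).trans (le_of_sq_le_sq ?_ (norm_nonneg _))
    rw [Complex.sq_norm, Complex.normSq_apply]
    simp only [Complex.sub_re, Complex.sub_im, ← sq]
    exact norm_sub_sq_le (hx i hi) (hx j hj) (hcos i hi) (hcos j hj)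
  · intro i _
    have h1 := Complex.neg_pi_lt_arg ⟨x i 0, x i 1⟩
    have h2 := Complex.arg_le_pi ⟨x i 0, x i 1⟩
    simp only [longitude]
    constructor <;> nlinarith

theorem card_le_of_separated_on_sphere {ι : Type*} {P : Finset ι}
    {x : ι → EuclideanSpace ℝ (Fin 3)} (hx : ∀ i ∈ P, ‖x i‖ = 1) {d h : ℝ} (hd : 0 < d)
    (hP : ∀ i ∈ P, ∀ j ∈ P, i ≠ j → d ≤ ‖x i - x j‖) {K : ℕ} (hh : 0 < h) (hK : K * h = π / 2) :
    (#P : ℝ) * (√3 / 2 * d ^ 2) ≤ ∑ k ∈ Finset.range (K + 1),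
      2 * ((2 * π * cos (k * h) + 2 * d / √3) * (h + 2 * d / √3)) := by
  classical
  have hpi := pi_pos
  let north : ℕ → Finset ι := fun k => {i ∈ P | latitude (x i) ∈ Set.Icc (k * h) (k * h + h)}
  let south : ℕ → Finset ι := fun k =>
    {i ∈ P | latitude (x i) ∈ Set.Icc (-(k * h) - h) (-(k * h) - h + h)}
  have hcover : P ⊆ (Finset.range (K + 1)).biUnion fun k => north k ∪ south k := by
    intro i hi
    have habs : |latitude (x i)| ≤ K * h := by
      rw [hK]
      exact abs_le.2 ⟨neg_pi_div_two_le_arcsin _, arcsin_le_pi_div_two _⟩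
    have f1 := Nat.floor_le (div_nonneg (abs_nonneg (latitude (x i))) hh.le)
    have f2 := Nat.lt_floor_add_one (|latitude (x i)| / h)
    have f3 : ⌊|latitude (x i)| / h⌋₊ ≤ K :=
      Nat.floor_le_of_le (by rwa [div_le_iff₀ hh])
    generalize ⌊|latitude (x i)| / h⌋₊ = k at *
    rw [le_div_iff₀ hh] at f1
    rw [div_lt_iff₀ hh] at f2
    refine Finset.mem_biUnion.2 ⟨k, Finset.mem_range.2 (by omega), Finset.mem_union.2 ?_⟩
    rcases le_total 0 (latitude (x i)) with h0 | h0
    · rw [abs_of_nonneg h0] at f1 f2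
      exact Or.inl (Finset.mem_filter.2 ⟨hi, f1, by linarith⟩)
    · rw [abs_of_nonpos h0] at f1 f2
      exact Or.inr (Finset.mem_filter.2 ⟨hi, by linarith, by linarith⟩)
  have hstrip : ∀ k ∈ Finset.range (K + 1), (#(north k ∪ south k) : ℝ) * (√3 / 2 * d ^ 2) ≤
      2 * ((2 * π * cos (k * h) + 2 * d / √3) * (h + 2 * d / √3)) := by
    intro k hk
    have hkK : (k : ℝ) ≤ K := by exact_mod_cast Nat.lt_succ_iff.1 (Finset.mem_range.1 hk)
    have hkh0 : 0 ≤ k * h := by positivity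
    have hkh1 : k * h ≤ π / 2 := by rw [← hK]; gcongr
    have hr : 0 ≤ cos (k * h) := cos_nonneg_of_mem_Icc ⟨by linarith, hkh1⟩
    have hcos : ∀ i, k * h ≤ |latitude (x i)| → cos (latitude (x i)) ≤ cos (k * h) := by
      intro i hi
      have habs : |latitude (x i)| ≤ π / 2 :=
        abs_le.2 ⟨neg_pi_div_two_le_arcsin _, arcsin_le_pi_div_two _⟩
      rw [← cos_abs (latitude (x i))]
      exact cos_le_cos_of_nonneg_of_le_pi hkh0 (by linarith) hi
    have hn := card_le_of_separated_in_strip (P := north k) (x := x)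
      (fun i hi => hx i (Finset.mem_filter.1 hi).1) hd hh.le hr
      (fun i hi j hj => hP i (Finset.mem_filter.1 hi).1 j (Finset.mem_filter.1 hj).1)
      (fun i hi => (Finset.mem_filter.1 hi).2)
      (fun i hi => hcos i ((Finset.mem_filter.1 hi).2.1.trans (le_abs_self _)))
    have hs := card_le_of_separated_in_strip (P := south k) (x := x)
      (fun i hi => hx i (Finset.mem_filter.1 hi).1) hd hh.le hr
      (fun i hi j hj => hP i (Finset.mem_filter.1 hi).1 j (Finset.mem_filter.1 hj).1)
      (fun i hi => (Finset.mem_filter.1 hi).2)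
      (fun i hi => hcos i (le_trans (by linarith [(Finset.mem_filter.1 hi).2.2]) (neg_le_abs _)))
    have hu : (#(north k ∪ south k) : ℝ) ≤ #(north k) + #(south k) := by
      exact_mod_cast Finset.card_union_le _ _
    have := mul_le_mul_of_nonneg_right hu (show 0 ≤ √3 / 2 * d ^ 2 by positivity)
    linarith
  have hcard : (#P : ℝ) ≤ ∑ k ∈ Finset.range (K + 1), (#(north k ∪ south k) : ℝ) := by
    exact_mod_cast (Finset.card_le_card hcover).trans Finset.card_biUnion_le
  refine (mul_le_mul_of_nonneg_right hcard (by positivity)).trans ?_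
  rw [Finset.sum_mul]
  exact Finset.sum_le_sum hstrip

theorem sum_mul_cos_le {h : ℝ} {K : ℕ} (hh : 0 < h) (hK : K * h = π / 2) :
    ∑ k ∈ Finset.range (K + 1), h * cos (k * h) ≤ 1 + h := by
  have step : ∀ k ∈ Finset.range K, h * cos ((k + 1 : ℕ) * h) ≤
      sin ((k + 1 : ℕ) * h) - sin (k * h) := by
    intro k hk
    have hkK : ((k + 1 : ℕ) : ℝ) ≤ K := by exact_mod_cast Finset.mem_range.1 hk
    have hk1 : (k + 1 : ℕ) * h ≤ π / 2 := by rw [← hK]; gcongr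
    have hk0 : 0 ≤ k * h := by positivity
    have := (convex_Icc (k * h) ((k + 1 : ℕ) * h)).mul_sub_le_image_sub_of_le_deriv
      (f := sin) (C := cos ((k + 1 : ℕ) * h)) continuous_sin.continuousOn
      differentiable_sin.differentiableOn ?_ (k * h) ?_ ((k + 1 : ℕ) * h) ?_ ?_
    · push_cast at this ⊢
      linarith
    · intro t ht
      rw [interior_Icc] at ht
      rw [Real.deriv_sin]
      exact cos_le_cos_of_nonneg_of_le_pi (by linarith [ht.1]) (by linarith [pi_pos]) ht.2.le
    · exact Set.left_mem_Icc.2 (by push_cast; linarith)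
    · exact Set.right_mem_Icc.2 (by push_cast; linarith)
    · push_cast; linarith
  rw [Finset.sum_range_succ']
  have := Finset.sum_le_sum step
  rw [Finset.sum_range_sub (fun k : ℕ => sin (k * h)), hK, sin_pi_div_two] at this
  simp only [Nat.cast_zero, zero_mul, sin_zero, cos_zero] at this ⊢
  linarith

/-- Asymptotic packing bound on the sphere: `d`-separated sets have at most
`(8π/√3 + o(1)) / d²` points as `d → 0`. -/
theorem eventually_card_le_of_separated {e : ℝ} (he : 0 < e) :
    ∀ᶠ d in nhdsWithin (0 : ℝ) (Set.Ioi 0), ∀ {n : ℕ} (P : Finset (Fin n))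
      (x : Fin n → EuclideanSpace ℝ (Fin 3)), (∀ i, ‖x i‖ = 1) →
      (∀ i ∈ P, ∀ j ∈ P, i ≠ j → d ≤ ‖x i - x j‖) →
      (#P : ℝ) * (√3 / 2 * d ^ 2) ≤ 4 * π + e := by
  have hpi := pi_pos
  obtain ⟨K, hK⟩ := exists_nat_gt (2 * π ^ 2 / e)
  have hK0 : (0 : ℝ) < K := lt_of_le_of_lt (by positivity) hK
  set h : ℝ := π / (2 * K) with hh
  have hpos : 0 < h := by positivity
  have hKh : K * h = π / 2 := by rw [hh]; field_simp
  have hsmall : 4 * π * h < e := by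
    rw [div_lt_iff₀ he] at hK
    have : 4 * π * h = 2 * π ^ 2 / K := by rw [hh]; field_simp; norm_num
    rw [this, div_lt_iff₀ hK0]
    linarith
  let G : ℝ → ℝ := fun d => ∑ k ∈ Finset.range (K + 1),
    2 * ((2 * π * cos (k * h) + 2 * d / √3) * (h + 2 * d / √3))
  have hG : Continuous G := by fun_prop
  have hG0 : G 0 < 4 * π + e := by
    have : G 0 = 4 * π * ∑ k ∈ Finset.range (K + 1), h * cos (k * h) := by
      rw [Finset.mul_sum]
      refine Finset.sum_congr rfl fun k _ => ?_
      ring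
    have := mul_le_mul_of_nonneg_left (sum_mul_cos_le hpos hKh) (show 0 ≤ 4 * π by positivity)
    linarith
  filter_upwards [nhdsWithin_le_nhds (hG.continuousAt.eventually_lt_const hG0),
    self_mem_nhdsWithin] with d hd hd0 n P x hx hP
  exact (card_le_of_separated_on_sphere (fun i _ => hx i) hd0 hP hpos hKh).trans hd.le

theorem close_pairs_count (s : ℝ) (hs : 0 < s)
    (x : (n : ℕ) → Fin n → EuclideanSpace ℝ (Fin 3))
    (hx : ∀ n, ∀ i, ‖x n i‖ = 1)
    (hinj : ∀ n, Function.Injective (x n)) :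
    1 - 4 / s ^ 2 * (2 * π / Real.sqrt 3) ≤
      Filter.atTop.liminf (fun n : ℕ =>
        ((Finset.univ.filter (fun i : Fin n =>
          ∃ j : Fin n, j ≠ i ∧ ‖x n i - x n j‖ ≤ s / Real.sqrt n)).card : ℝ) / n) := by
  have h3 : 0 < √3 := by positivity
  refine le_of_forall_pos_sub_le fun e he => ?_
  refine le_liminf_of_le ?_ ?_
  · refine IsBoundedUnder.isCoboundedUnder_ge ⟨1,
      eventually_map.2 (Eventually.of_forall fun n => ?_)⟩
    refine div_le_one_of_le₀ ?_ (Nat.cast_nonneg n)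
    exact_mod_cast (Finset.card_le_univ _).trans (Fintype.card_fin n).le
  have hlim : Tendsto (fun n : ℕ => s / √n) atTop (nhdsWithin 0 (Set.Ioi 0)) := by
    refine tendsto_nhdsWithin_iff.2 ⟨?_, ?_⟩
    · exact (tendsto_sqrt_atTop.comp tendsto_natCast_atTop_atTop).const_div_atTop s
    · filter_upwards [eventually_gt_atTop 0] with n hn
      have : (0 : ℝ) < n := by exact_mod_cast hn
      exact Set.mem_Ioi.2 (by positivity)
  have he' : 0 < e * (√3 / 2 * s ^ 2) := by positivity
  filter_upwards [hlim.eventually (eventually_card_le_of_separated he'),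
    eventually_gt_atTop 0] with n hn hn0
  have hn1 : (0 : ℝ) < n := by exact_mod_cast hn0
  have hsep := hn {i | ¬ ∃ j : Fin n, j ≠ i ∧ ‖x n i - x n j‖ ≤ s / √n} (x n) (hx n) (by
    intro i hi j _ hij
    have := (Finset.mem_filter.1 hi).2
    push Not at this
    exact (this j hij.symm).le)
  have hcount := Finset.card_filter_add_card_filter_not (s := (Finset.univ : Finset (Fin n)))
    (fun i => ∃ j : Fin n, j ≠ i ∧ ‖x n i - x n j‖ ≤ s / √n)
  rw [Finset.card_univ, Fintype.card_fin] at hcount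
  have hcount' := congrArg (Nat.cast : ℕ → ℝ) hcount
  push_cast at hcount'
  rw [div_pow, Real.sq_sqrt hn1.le] at hsep
  rw [le_div_iff₀ hn1]
  generalize (#{i | ¬ ∃ j : Fin n, j ≠ i ∧ ‖x n i - x n j‖ ≤ s / √n} : ℝ) = M at *
  have hM : M ≤ (4 / s ^ 2 * (2 * π / √3) + e) * n := by
    have hc : 0 < √3 / 2 * (s ^ 2 / n) := by positivity
    refine le_of_mul_le_mul_right (hsep.trans_eq ?_) hc
    field_simp
  nlinarith
end

section
/- Let L(q) = ∑_{m,n ∈ ℤ} q^{m²+mn+n²} for 0 < q < 1, and let γ be the Euler–Mascheroni constant. Then the limit as c → ∞ of ∫₀^c (1/(2s))·( L(exp(−2π/(√3·s))) − 1 ) ds − c/2 + log(4c)/2 − γ/2 exists and equals 2·log 2 + (1/2)·log(2/3) + 3·log(√π / Γ(1/3)), where Γ is the Gamma function. (This value is the Brauchart–Hardin–Saff constant c_BHS ≈ −0.055605.) -/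
open MeasureTheory Real Filter

/-- The cubic analogue of the Jacobi theta function:
`L(q) = ∑_{m,n ∈ ℤ} q^(m² + mn + n²)`. -/
noncomputable def cubicTheta (q : ℝ) : ℝ :=
  ∑' p : ℤ × ℤ, q ^ (p.1 ^ 2 + p.1 * p.2 + p.2 ^ 2)

/-- The pairs of integers representing `n` by the form `x² + xy + y²`. -/
def eisensteinReps (n : ℤ) : Set (ℤ × ℤ) := {z | z.1 ^ 2 + z.1 * z.2 + z.2 ^ 2 = n}

lemma mem_eisensteinReps {n : ℤ} {z : ℤ × ℤ} :
    z ∈ eisensteinReps n ↔ z.1 ^ 2 + z.1 * z.2 + z.2 ^ 2 = n := Iff.rfl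

lemma finite_eisensteinReps (n : ℤ) : (eisensteinReps n).Finite := by
  refine ((Set.finite_Icc (-(2 * |n|)) (2 * |n|)).prod
    (Set.finite_Icc (-(2 * |n|)) (2 * |n|))).subset fun ⟨x, y⟩ h => ?_
  rw [mem_eisensteinReps] at h
  dsimp only at h
  have hn : 0 ≤ n := by nlinarith [sq_nonneg (x + y), sq_nonneg x, sq_nonneg y]
  have key (t : ℤ) (ht : t ^ 2 ≤ 2 * n) : t ∈ Set.Icc (-(2 * |n|)) (2 * |n|) := by
    rw [abs_of_nonneg hn]
    constructor
    · rcases le_or_gt 0 t with h0 | h0 <;> nlinarith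
    · rcases le_or_gt t 0 with h0 | h0 <;> nlinarith
  exact ⟨key x (by nlinarith [sq_nonneg (x + y), sq_nonneg x, sq_nonneg y]),
    key y (by nlinarith [sq_nonneg (x + y), sq_nonneg x, sq_nonneg y])⟩

lemma eisensteinReps_zero : eisensteinReps 0 = {(0, 0)} := by
  ext ⟨x, y⟩
  simp only [mem_eisensteinReps, Set.mem_singleton_iff, Prod.mk.injEq]
  constructor
  · intro h
    have hx : x ^ 2 ≤ 0 := by nlinarith [sq_nonneg (x + y), sq_nonneg x, sq_nonneg y]
    have hy : y ^ 2 ≤ 0 := by nlinarith [sq_nonneg (x + y), sq_nonneg x, sq_nonneg y]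
    exact ⟨by nlinarith, by nlinarith⟩
  · rintro ⟨rfl, rfl⟩
    rfl

lemma ncard_eisensteinReps_one : (eisensteinReps 1).ncard = 6 := by
  have : eisensteinReps 1 =
      (({(1, 0), (-1, 0), (0, 1), (0, -1), (1, -1), (-1, 1)} : Finset (ℤ × ℤ)) :
        Set (ℤ × ℤ)) := by
    ext ⟨x, y⟩
    simp only [mem_eisensteinReps, Finset.coe_insert, Finset.coe_singleton, Set.mem_insert_iff,
      Set.mem_singleton_iff, Prod.mk.injEq]
    constructor
    · intro h
      have hx : x ^ 2 ≤ 2 := by nlinarith [sq_nonneg (x + y), sq_nonneg x, sq_nonneg y]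
      have hy : y ^ 2 ≤ 2 := by nlinarith [sq_nonneg (x + y), sq_nonneg x, sq_nonneg y]
      have hx1 : -1 ≤ x := by nlinarith
      have hx2 : x ≤ 1 := by nlinarith
      have hy1 : -1 ≤ y := by nlinarith
      have hy2 : y ≤ 1 := by nlinarith
      interval_cases x <;> interval_cases y <;> simp_all
    · rintro (⟨rfl, rfl⟩ | ⟨rfl, rfl⟩ | ⟨rfl, rfl⟩ | ⟨rfl, rfl⟩ | ⟨rfl, rfl⟩ | ⟨rfl, rfl⟩) <;> rfl
  rw [this, Set.ncard_coe_finset]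
  rfl

lemma ncard_eisensteinReps_three_mul (n : ℤ) :
    (eisensteinReps (3 * n)).ncard = (eisensteinReps n).ncard := by
  have : eisensteinReps (3 * n) = (fun z : ℤ × ℤ => (z.1 - z.2, z.1 + 2 * z.2)) ''
      eisensteinReps n := by
    ext ⟨x, y⟩
    simp only [mem_eisensteinReps, Set.mem_image, Prod.mk.injEq, Prod.exists]
    constructor
    · intro h
      have h3 : (3 : ℤ) ∣ y - x := by
        refine Int.prime_three.dvd_of_dvd_pow (n := 2) ⟨n - x * y, ?_⟩
        linarith
      obtain ⟨k, hk⟩ := h3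
      obtain rfl : y = x + 3 * k := by linarith
      exact ⟨x + k, k, by nlinarith, by ring, by ring⟩
    · rintro ⟨a, b, h, rfl, rfl⟩
      linear_combination 3 * h
  rw [this, Set.ncard_image_of_injective]
  rintro ⟨a, b⟩ ⟨c, d⟩ h
  simp only [Prod.mk.injEq] at h
  ext <;> dsimp only <;> omega

/-- The pairs representing `n` whose two entries are divisible by `p`. -/
def eisensteinRepsDvd (p n : ℤ) : Set (ℤ × ℤ) := {z ∈ eisensteinReps n | p ∣ z.1 ∧ p ∣ z.2}

lemma ncard_eisensteinRepsDvd_of_dvd {p : ℤ} (hp : p ≠ 0) (n : ℤ) :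
    (eisensteinRepsDvd p (p * (p * n))).ncard = (eisensteinReps n).ncard := by
  have : eisensteinRepsDvd p (p * (p * n)) = (fun z : ℤ × ℤ => (p * z.1, p * z.2)) ''
      eisensteinReps n := by
    ext ⟨x, y⟩
    simp only [eisensteinRepsDvd, Set.mem_ofPred_eq, mem_eisensteinReps, Set.mem_image,
      Prod.mk.injEq, Prod.exists]
    constructor
    · rintro ⟨h, ⟨a, rfl⟩, ⟨b, rfl⟩⟩
      refine ⟨a, b, ?_, rfl, rfl⟩
      apply mul_left_cancel₀ (mul_ne_zero hp hp)
      linarith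
    · rintro ⟨a, b, h, rfl, rfl⟩
      exact ⟨by rw [← h]; ring, dvd_mul_right _ _, dvd_mul_right _ _⟩
  rw [this, Set.ncard_image_of_injective]
  rintro ⟨a, b⟩ ⟨c, d⟩ h
  simpa [hp] using h

lemma ncard_eisensteinRepsDvd_of_not_dvd {p n : ℤ} (hp : p ≠ 0) (h : ¬ p ∣ n) :
    (eisensteinRepsDvd p (p * n)).ncard = 0 := by
  have : eisensteinRepsDvd p (p * n) = ∅ := by
    rw [Set.eq_empty_iff_forall_notMem]
    rintro ⟨x, y⟩ ⟨hz, ⟨a, ha⟩, ⟨b, hb⟩⟩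
    dsimp only at ha hb
    subst ha hb
    rw [mem_eisensteinReps] at hz
    refine h ⟨a ^ 2 + a * b + b ^ 2, mul_left_cancel₀ hp ?_⟩
    rw [← hz]; ring
  rw [this, Set.ncard_empty]

lemma eisensteinReps_eq_dvd_of_inert {p : ℕ} (hp : p.Prime) (h2 : p % 3 = 2) (n : ℤ) :
    eisensteinReps (p * n) = eisensteinRepsDvd p (p * n) := by
  have hpz : Prime (p : ℤ) := Nat.prime_iff_prime_int.mp hp
  ext ⟨x, y⟩
  refine ⟨fun h => ⟨h, ?_⟩, fun h => h.1⟩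
  rw [mem_eisensteinReps] at h
  dsimp only at h ⊢
  have hd : (p : ℤ) ∣ x ^ 2 + x * y + y ^ 2 := ⟨n, h⟩
  have : Fact p.Prime := ⟨hp⟩
  by_contra hcon
  have hy : ¬ (p : ℤ) ∣ y := by
    intro hy
    refine hcon ⟨hpz.dvd_of_dvd_pow (n := 2) ?_, hy⟩
    have : x ^ 2 = x ^ 2 + x * y + y ^ 2 - y * (x + y) := by ring
    rw [this]
    exact dvd_sub hd (hy.mul_right _)
  have hx : ¬ (p : ℤ) ∣ x := by
    intro hx
    refine hy (hpz.dvd_of_dvd_pow (n := 2) ?_)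
    have : y ^ 2 = x ^ 2 + x * y + y ^ 2 - x * (x + y) := by ring
    rw [this]
    exact dvd_sub hd (hx.mul_right _)
  rw [← ZMod.intCast_zmod_eq_zero_iff_dvd] at hx hy hd
  push_cast at hd
  have h3 : (x : ZMod p) ^ 3 = (y : ZMod p) ^ 3 := by
    linear_combination ((x : ZMod p) - y) * hd
  have hxy : (x : ZMod p) = y := by
    have hk : p - 1 = 3 * ((p - 2) / 3) + 1 := by have := hp.two_le; omega
    have e1 := ZMod.pow_card_sub_one_eq_one hx
    have e2 := ZMod.pow_card_sub_one_eq_one hy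
    rw [hk, pow_succ, pow_mul] at e1 e2
    rw [h3] at e1
    have hne : ((y : ZMod p) ^ 3) ^ ((p - 2) / 3) ≠ 0 := pow_ne_zero _ (pow_ne_zero _ hy)
    exact mul_left_cancel₀ hne (e1.trans e2.symm)
  rw [hxy] at hd
  have h30 : (3 : ZMod p) = 0 := by
    have : (3 : ZMod p) * (y : ZMod p) ^ 2 = 0 := by linear_combination hd
    exact (mul_eq_zero.mp this).resolve_right (pow_ne_zero _ hy)
  have : ((3 : ℕ) : ZMod p) = 0 := by exact_mod_cast h30
  rw [ZMod.natCast_eq_zero_iff, Nat.prime_dvd_prime_iff_eq hp Nat.prime_three] at this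
  omega

/-- A prime `p ≡ 1 mod 3` is of the form `a² + ab + b²`. -/
lemma exists_eisensteinReps_of_split {p : ℕ} (hp : p.Prime) (h1 : p % 3 = 1) :
    ∃ a b : ℤ, a ^ 2 + a * b + b ^ 2 = p := by
  have : Fact p.Prime := ⟨hp⟩
  obtain ⟨u, hu⟩ : ∃ u : ZMod p, u ^ 2 + u + 1 = 0 := by
    have h3 : 3 ∣ Fintype.card (ZMod p)ˣ := by
      rw [ZMod.card_units]; have := hp.one_le; omega
    obtain ⟨w, hw⟩ := exists_prime_orderOf_dvd_card 3 h3
    refine ⟨w, ?_⟩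
    have hw3 : ((w : ZMod p)) ^ 3 = 1 := by
      rw [← Units.val_pow_eq_pow_val, ← hw, pow_orderOf_eq_one, Units.val_one]
    have hw1 : (w : ZMod p) - 1 ≠ 0 := by
      intro h
      have : w = 1 := Units.ext (by simpa using sub_eq_zero.mp h)
      rw [this, orderOf_one] at hw
      omega
    apply mul_left_cancel₀ hw1
    linear_combination hw3
  set k := Nat.sqrt p with hk
  have hklt : p < (k + 1) * (k + 1) := Nat.lt_succ_sqrt p
  have hkle : k * k < p := by
    refine lt_of_le_of_ne (Nat.sqrt_le p) fun h => ?_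
    have hk1 : k ≠ 1 := by
      intro h1
      rw [h1] at h
      exact hp.one_lt.ne h
    rw [← h] at hp
    exact Nat.not_prime_mul hk1 hk1 hp
  obtain ⟨⟨i, j⟩, ⟨i', j'⟩, hne, heq⟩ := Fintype.exists_ne_map_eq_of_card_lt
    (fun z : Fin (k + 1) × Fin (k + 1) => ((z.1 : ℕ) : ZMod p) - u * ((z.2 : ℕ) : ZMod p))
    (by simpa [ZMod.card] using hklt)
  dsimp only at heq
  set x : ℤ := (i : ℤ) - i' with hx
  set y : ℤ := (j : ℤ) - j' with hy
  have hxy : (x : ZMod p) = u * y := by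
    rw [hx, hy]; push_cast; linear_combination heq
  have hdvd : (p : ℤ) ∣ x ^ 2 + x * y + y ^ 2 := by
    rw [← ZMod.intCast_zmod_eq_zero_iff_dvd]
    push_cast
    rw [hxy]
    linear_combination (y : ZMod p) ^ 2 * hu
  have hne0 : x ≠ 0 ∨ y ≠ 0 := by
    by_contra! hcon
    apply hne
    ext <;> simp only <;> omega
  have hxb : x ^ 2 < p := by
    have : x ^ 2 ≤ (k : ℤ) ^ 2 := sq_le_sq' (by omega) (by omega)
    have h' : ((k * k : ℕ) : ℤ) < p := by exact_mod_cast hkle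
    push_cast at h'
    nlinarith
  have hyb : y ^ 2 < p := by
    have : y ^ 2 ≤ (k : ℤ) ^ 2 := sq_le_sq' (by omega) (by omega)
    have h' : ((k * k : ℕ) : ℤ) < p := by exact_mod_cast hkle
    push_cast at h'
    nlinarith
  obtain ⟨m, hm⟩ := hdvd
  have hp0 : (0 : ℤ) < p := by exact_mod_cast hp.pos
  have hmpos : 0 < m := by
    have : 0 < x ^ 2 + x * y + y ^ 2 := by
      rcases hne0 with h | h
      · have := pow_pos (abs_pos.mpr h) 2
        rw [sq_abs] at this
        nlinarith [sq_nonneg (x + y), sq_nonneg (x + 2 * y)]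
      · have := pow_pos (abs_pos.mpr h) 2
        rw [sq_abs] at this
        nlinarith [sq_nonneg (x + y), sq_nonneg (2 * x + y)]
    rw [hm] at this
    exact pos_of_mul_pos_right this hp0.le
  have hm3 : m < 3 := by nlinarith [sq_nonneg (x - y)]
  interval_cases m
  · exact ⟨x, y, by linarith⟩
  · exfalso
    have hpodd : (p : ℤ) % 2 = 1 := by
      rcases hp.eq_two_or_odd with h | h
      · omega
      · omega
    rcases Int.even_or_odd' x with ⟨a, ha | ha⟩ <;> rcases Int.even_or_odd' y with ⟨b, hb | hb⟩ <;>
      rw [ha, hb] at hm <;> ring_nf at hm <;> omega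

lemma ncard_eisensteinReps_of_split {p : ℕ} (hp : p.Prime) {a b : ℤ}
    (hab : a ^ 2 + a * b + b ^ 2 = p) (h3 : p ≠ 3) (n : ℤ) :
    (eisensteinReps (p * n)).ncard + (eisensteinRepsDvd p (p * n)).ncard =
      2 * (eisensteinReps n).ncard := by
  have hpz : Prime (p : ℤ) := Nat.prime_iff_prime_int.mp hp
  have hp0 : (p : ℤ) ≠ 0 := hpz.ne_zero
  have hfin := finite_eisensteinReps (p * n)
  -- multiples of an element of norm `p`
  have mult (a b : ℤ) (hab : a ^ 2 + a * b + b ^ 2 = p) :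
      {z ∈ eisensteinReps (p * n) | (p : ℤ) ∣ b * z.1 - a * z.2}.ncard =
        (eisensteinReps n).ncard := by
    have : {z ∈ eisensteinReps (p * n) | (p : ℤ) ∣ b * z.1 - a * z.2} =
        (fun z : ℤ × ℤ => (a * z.1 - b * z.2, b * z.1 + (a + b) * z.2)) '' eisensteinReps n := by
      ext ⟨x, y⟩
      simp only [Set.mem_ofPred_eq, mem_eisensteinReps, Set.mem_image, Prod.mk.injEq, Prod.exists]
      constructor
      · rintro ⟨h, k, hk⟩
        obtain ⟨l, hl⟩ : (p : ℤ) ∣ (a + b) * x + b * y := by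
          refine hpz.dvd_of_dvd_pow (n := 2) ?_
          have e : ((a + b) * x + b * y) ^ 2 =
              (p : ℤ) * (p * n + ((a + b) * x + b * y) * k - p * k ^ 2) := by
            linear_combination p * h + (x ^ 2 + x * y + y ^ 2) * hab +
              ((a + b) * x + b * y - (b * x - a * y) - p * k) * hk
          exact ⟨_, e⟩
        refine ⟨l, -k, ?_, ?_, ?_⟩
        · apply mul_left_cancel₀ (mul_ne_zero hp0 hp0)
          have hl' : (p : ℤ) * l = (a + b) * x + b * y := hl.symm
          have hk' : (p : ℤ) * k = b * x - a * y := hk.symm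
          calc (p : ℤ) * p * (l ^ 2 + l * -k + (-k) ^ 2)
              = (p * l) ^ 2 - (p * l) * (p * k) + (p * k) ^ 2 := by ring
            _ = (a ^ 2 + a * b + b ^ 2) * (x ^ 2 + x * y + y ^ 2) := by rw [hl', hk']; ring
            _ = _ := by rw [hab, h]; ring
        · apply mul_left_cancel₀ hp0
          linear_combination (-a) * hl - b * hk + x * hab
        · apply mul_left_cancel₀ hp0
          linear_combination (-b) * hl + (a + b) * hk + y * hab
      · rintro ⟨c, d, h, rfl, rfl⟩
        refine ⟨?_, -d, ?_⟩
        · rw [← hab, ← h]; ring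
        · rw [← hab]; ring
    rw [this, Set.ncard_image_of_injective]
    rintro ⟨c, d⟩ ⟨c', d'⟩ h
    simp only [Prod.mk.injEq] at h
    obtain ⟨e1, e2⟩ := h
    have hc : (p : ℤ) * c = p * c' := by
      rw [← hab]; linear_combination (a + b) * e1 + b * e2
    have hd : (p : ℤ) * d = p * d' := by
      rw [← hab]; linear_combination (-b) * e1 + a * e2
    exact Prod.ext (mul_left_cancel₀ hp0 hc) (mul_left_cancel₀ hp0 hd)
  set A := {z ∈ eisensteinReps (p * n) | (p : ℤ) ∣ b * z.1 - a * z.2} with hA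
  set B := {z ∈ eisensteinReps (p * n) | (p : ℤ) ∣ -b * z.1 - (a + b) * z.2} with hB
  have hcA : A.ncard = (eisensteinReps n).ncard := mult a b hab
  have hcB : B.ncard = (eisensteinReps n).ncard := mult (a + b) (-b) (by linarith)
  have hAf : A.Finite := hfin.subset fun z hz => hz.1
  have hBf : B.Finite := hfin.subset fun z hz => hz.1
  have hunion : A ∪ B = eisensteinReps (p * n) := by
    ext ⟨x, y⟩
    constructor
    · rintro (h | h) <;> exact h.1
    · intro h
      have h' := mem_eisensteinReps.mp h
      dsimp only at h'
      have : (p : ℤ) ∣ (b * x - a * y) * (-b * x - (a + b) * y) := by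
        refine ⟨y ^ 2 - b ^ 2 * n, ?_⟩
        linear_combination (-b ^ 2) * h' + y ^ 2 * hab
      rcases hpz.dvd_or_dvd this with hd | hd
      · exact Or.inl ⟨h, hd⟩
      · exact Or.inr ⟨h, hd⟩
  have hb : ¬ (p : ℤ) ∣ b := by
    intro hb
    have ha : (p : ℤ) ∣ a := by
      refine hpz.dvd_of_dvd_pow (n := 2) ?_
      have : a ^ 2 = p - b * (a + b) := by linear_combination hab
      rw [this]
      exact dvd_sub dvd_rfl (hb.mul_right _)
    obtain ⟨a', rfl⟩ := ha
    obtain ⟨b', rfl⟩ := hb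
    have : (p : ℤ) * (a' ^ 2 + a' * b' + b' ^ 2) = 1 := by
      apply mul_left_cancel₀ hp0
      linear_combination hab
    exact hpz.not_isUnit (IsUnit.of_mul_eq_one _ this)
  have h2ab : ¬ (p : ℤ) ∣ 2 * a + b := by
    intro h
    have : (p : ℤ) ∣ 3 * b ^ 2 := by
      have e : 3 * b ^ 2 = p * 4 - (2 * a + b) * (2 * a + b) := by linear_combination 4 * hab
      rw [e]
      exact dvd_sub (dvd_mul_right _ _) (h.mul_right _)
    rcases hpz.dvd_or_dvd this with h | h
    · have h' : p ∣ 3 := by exact_mod_cast h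
      exact h3 ((Nat.prime_dvd_prime_iff_eq hp Nat.prime_three).mp h')
    · exact hb (hpz.dvd_of_dvd_pow h)
  have hinter : A ∩ B = eisensteinRepsDvd p (p * n) := by
    ext ⟨x, y⟩
    constructor
    · rintro ⟨⟨h, h1⟩, -, h2⟩
      dsimp only at h1 h2
      have hy : (p : ℤ) ∣ y := by
        have : (p : ℤ) ∣ (2 * a + b) * y := by
          rw [show (2 * a + b) * y = -((b * x - a * y) + (-b * x - (a + b) * y)) by ring]
          exact dvd_neg.mpr (dvd_add h1 h2)
        exact (hpz.dvd_or_dvd this).resolve_left h2ab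
      have hx : (p : ℤ) ∣ x := by
        have : (p : ℤ) ∣ b * x := by
          rw [show b * x = (b * x - a * y) + a * y by ring]
          exact dvd_add h1 (hy.mul_left a)
        exact (hpz.dvd_or_dvd this).resolve_left hb
      exact ⟨h, hx, hy⟩
    · rintro ⟨h, hx, hy⟩
      exact ⟨⟨h, dvd_sub (hx.mul_left _) (hy.mul_left _)⟩,
        ⟨h, dvd_sub (hx.mul_left _) (hy.mul_left _)⟩⟩
  have := Set.ncard_union_add_ncard_inter A B hAf hBf
  rw [hunion, hinter, hcA, hcB] at this
  omega

/-- The sum of the values of the quadratic character modulo `3` over the divisors of `n`. -/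
def divisorCharSum (n : ℕ) : ℤ := ∑ d ∈ n.divisors, quadraticChar (ZMod 3) (d : ZMod 3)

lemma divisorCharSum_prime_mul {p m : ℕ} (hp : p.Prime) (hm : m ≠ 0) :
    divisorCharSum (p * m) = divisorCharSum m + quadraticChar (ZMod 3) (p : ZMod 3) *
      (divisorCharSum m - if p ∣ m then divisorCharSum (m / p) else 0) := by
  have hsub : m.divisors ⊆ (p * m).divisors :=
    Nat.divisors_subset_of_dvd (mul_ne_zero hp.ne_zero hm) (dvd_mul_left _ _)
  have key : ∑ d ∈ (p * m).divisors \ m.divisors, quadraticChar (ZMod 3) (d : ZMod 3) =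
      ∑ d ∈ m.divisors with ¬ p * d ∣ m,
        quadraticChar (ZMod 3) (p : ZMod 3) * quadraticChar (ZMod 3) (d : ZMod 3) := by
    symm
    refine Finset.sum_bij (fun d _ => p * d) ?_ ?_ ?_ ?_
    · intro d hd
      simp only [Finset.mem_filter, Nat.mem_divisors] at hd
      simp only [Finset.mem_sdiff, Nat.mem_divisors]
      exact ⟨⟨mul_dvd_mul_left p hd.1.1, mul_ne_zero hp.ne_zero hm⟩, fun h => hd.2 h.1⟩
    · intro d _ d' _ h
      exact Nat.eq_of_mul_eq_mul_left hp.pos h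
    · intro e he
      simp only [Finset.mem_sdiff, Nat.mem_divisors] at he
      have hpe : p ∣ e := by
        by_contra hpe
        have hc : Nat.Coprime e p := ((Nat.Prime.coprime_iff_not_dvd hp).2 hpe).symm
        exact he.2 ⟨hc.dvd_of_dvd_mul_left he.1.1, hm⟩
      obtain ⟨d, rfl⟩ := hpe
      refine ⟨d, ?_, rfl⟩
      simp only [Finset.mem_filter, Nat.mem_divisors]
      exact ⟨⟨Nat.dvd_of_mul_dvd_mul_left hp.pos he.1.1, hm⟩, fun h => he.2 ⟨h, hm⟩⟩
    · intro d _
      rw [Nat.cast_mul, map_mul]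
  have hlow : ∑ d ∈ m.divisors with p * d ∣ m, quadraticChar (ZMod 3) (d : ZMod 3) =
      if p ∣ m then divisorCharSum (m / p) else 0 := by
    split_ifs with h
    · obtain ⟨k, rfl⟩ := h
      rw [Nat.mul_div_cancel_left _ hp.pos]
      refine Finset.sum_congr ?_ fun _ _ => rfl
      ext d
      simp only [Finset.mem_filter, Nat.mem_divisors]
      have hk : k ≠ 0 := right_ne_zero_of_mul hm
      constructor
      · rintro ⟨-, h⟩
        exact ⟨Nat.dvd_of_mul_dvd_mul_left hp.pos h, hk⟩
      · rintro ⟨h, -⟩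
        exact ⟨⟨h.mul_left p, hm⟩, mul_dvd_mul_left p h⟩
    · refine Finset.sum_eq_zero fun d hd => ?_
      exact absurd ((dvd_mul_right p d).trans (Finset.mem_filter.mp hd).2) h
  rw [← hlow, divisorCharSum, ← Finset.sum_sdiff hsub, key, ← Finset.mul_sum, divisorCharSum,
    ← Finset.sum_filter_add_sum_filter_not m.divisors (fun d => p * d ∣ m)]
  ring

lemma quadraticChar_three_natCast (n : ℕ) : quadraticChar (ZMod 3) (n : ZMod 3) =
    if n % 3 = 1 then 1 else if n % 3 = 2 then -1 else 0 := by
  rw [← ZMod.natCast_mod n 3]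
  have : n % 3 < 3 := Nat.mod_lt _ (by norm_num)
  interval_cases n % 3 <;> decide

lemma ncard_eisensteinReps_prime_mul {p m : ℕ} (hp : p.Prime) :
    ((eisensteinReps (p * m : ℕ)).ncard : ℤ) = (eisensteinReps m).ncard +
      quadraticChar (ZMod 3) (p : ZMod 3) * ((eisensteinReps m).ncard -
        if p ∣ m then ((eisensteinReps (m / p : ℕ)).ncard : ℤ) else 0) := by
  have hp0 : (p : ℤ) ≠ 0 := by exact_mod_cast hp.ne_zero
  have hdvd : ((eisensteinRepsDvd p (p * m)).ncard : ℤ) =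
      if p ∣ m then ((eisensteinReps (m / p : ℕ)).ncard : ℤ) else 0 := by
    split_ifs with h
    · obtain ⟨k, rfl⟩ := h
      rw [Nat.mul_div_cancel_left _ hp.pos, Nat.cast_mul, ncard_eisensteinRepsDvd_of_dvd hp0]
    · rw [ncard_eisensteinRepsDvd_of_not_dvd hp0 (by exact_mod_cast h), Nat.cast_zero]
  rw [← hdvd, quadraticChar_three_natCast, Nat.cast_mul]
  have h3 : p % 3 < 3 := Nat.mod_lt _ (by norm_num)
  split_ifs with h1 h2
  · obtain ⟨a, b, hab⟩ := exists_eisensteinReps_of_split hp h1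
    have := ncard_eisensteinReps_of_split hp hab (by rintro rfl; omega) m
    omega
  · rw [eisensteinReps_eq_dvd_of_inert hp h2]
    ring
  · have : p = 3 := ((Nat.prime_dvd_prime_iff_eq Nat.prime_three hp).mp (by omega)).symm
    subst this
    rw [Nat.cast_ofNat, ncard_eisensteinReps_three_mul]
    ring

/-- The number of representations of `n ≥ 1` by `x² + xy + y²`. -/
theorem ncard_eisensteinReps (n : ℕ) (hn : n ≠ 0) :
    ((eisensteinReps n).ncard : ℤ) = 6 * divisorCharSum n := by
  induction n using Nat.strong_induction_on with
  | _ n ih =>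
    rcases eq_or_ne n 1 with rfl | h1
    · rw [Nat.cast_one, ncard_eisensteinReps_one]
      simp [divisorCharSum]
    · obtain ⟨p, hp, m, rfl⟩ := Nat.exists_prime_and_dvd h1
      have hm : m ≠ 0 := right_ne_zero_of_mul hn
      have hlt : m < p * m := lt_mul_left (Nat.pos_of_ne_zero hm) hp.one_lt
      rw [ncard_eisensteinReps_prime_mul hp, divisorCharSum_prime_mul hp hm, ih m hlt hm]
      split_ifs with h
      · rw [ih (m / p) ((Nat.div_le_self m p).trans_lt hlt)
          (Nat.div_pos (Nat.le_of_dvd (Nat.pos_of_ne_zero hm) h) hp.pos).ne']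
        ring
      · ring

lemma tsum_quadraticChar_three_mul_pow {x : ℝ} (h0 : 0 ≤ x) (h1 : x < 1) :
    ∑' d : ℕ+, (quadraticChar (ZMod 3) ((d : ℕ) : ZMod 3) : ℝ) * x ^ (d : ℕ) =
      x / (1 + x + x ^ 2) := by
  set f : ℕ → ℝ := fun d => (quadraticChar (ZMod 3) (d : ZMod 3) : ℝ) * x ^ d with hf
  have hs : Summable f := by
    refine Summable.of_norm_bounded (summable_geometric_of_lt_one h0 h1) fun d => ?_
    rw [hf, norm_mul, norm_pow, Real.norm_of_nonneg h0]
    refine mul_le_of_le_one_left (by positivity) ?_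
    rw [quadraticChar_three_natCast]
    split_ifs <;> simp
  have e0 : ∑' d : ℕ+, f d = ∑' d, f d := by
    rw [← tsum_zero_pnat_eq_tsum_nat hs]
    simp [hf]
  have e1 := hs.sum_add_tsum_nat_add 3
  have e2 (d : ℕ) : f (d + 3) = x ^ 3 * f d := by
    simp only [hf, quadraticChar_three_natCast, Nat.add_mod_right]
    ring
  simp_rw [e2, tsum_mul_left] at e1
  have e3 : ∑ i ∈ Finset.range 3, f i = x - x ^ 2 := by
    simp only [hf, quadraticChar_three_natCast, Finset.sum_range_succ, Finset.sum_range_zero]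
    norm_num
    ring
  rw [e3] at e1
  change ∑' d : ℕ+, f d = _
  rw [e0, eq_div_iff (by positivity)]
  have hne : 1 - x ≠ 0 := by linarith
  apply mul_left_cancel₀ hne
  linear_combination -e1

lemma summable_quadraticChar_mul_pow {q : ℝ} (h0 : 0 ≤ q) (h1 : q < 1) :
    Summable fun c : ℕ+ × ℕ+ =>
      (quadraticChar (ZMod 3) ((c.2 : ℕ) : ZMod 3) : ℝ) * q ^ (c.1 * c.2 : ℕ) := by
  have hs := summable_prod_mul_pow 0 (r := q) (by rwa [Real.norm_of_nonneg h0])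
  refine Summable.of_norm_bounded hs fun c => ?_
  rw [norm_mul, norm_pow, Real.norm_of_nonneg h0, pow_zero]
  refine mul_le_mul_of_nonneg_right ?_ (by positivity)
  rw [quadraticChar_three_natCast]
  split_ifs <;> simp

lemma hasSum_divisorCharSum_mul_pow {q : ℝ} (h0 : 0 ≤ q) (h1 : q < 1) :
    HasSum (fun n : ℕ+ => (divisorCharSum n : ℝ) * q ^ (n : ℕ))
      (∑' k : ℕ+, q ^ (k : ℕ) / (1 + q ^ (k : ℕ) + (q ^ (k : ℕ)) ^ 2)) := by
  have hs := summable_quadraticChar_mul_pow h0 h1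
  have hS := (sigmaAntidiagonalEquivProd.hasSum_iff.mpr hs.hasSum)
  have hT := hS.sigma (g := fun n : ℕ+ => (divisorCharSum n : ℝ) * q ^ (n : ℕ)) fun n => by
    have h := hasSum_fintype fun x : (n : ℕ).divisorsAntidiagonal =>
      ((fun c : ℕ+ × ℕ+ => (quadraticChar (ZMod 3) ((c.2 : ℕ) : ZMod 3) : ℝ) *
        q ^ (c.1 * c.2 : ℕ)) ∘ sigmaAntidiagonalEquivProd) ⟨n, x⟩
    convert h using 1
    simp only [Function.comp_def, sigmaAntidiagonalEquivProd, divisorsAntidiagonalFactors,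
      PNat.mk_coe, Equiv.coe_fn_mk, Finset.univ_eq_attach]
    rw [(n : ℕ).divisorsAntidiagonal.sum_attach fun x : ℕ × ℕ =>
      (quadraticChar (ZMod 3) (x.2 : ZMod 3) : ℝ) * q ^ (x.1 * x.2),
      Nat.sum_divisorsAntidiagonal' fun x y =>
        (quadraticChar (ZMod 3) (y : ZMod 3) : ℝ) * q ^ (x * y),
      divisorCharSum, Int.cast_sum, Finset.sum_mul]
    refine Finset.sum_congr rfl fun d hd => ?_
    rw [Nat.div_mul_cancel (Nat.dvd_of_mem_divisors hd)]
  convert hT using 1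
  rw [hs.tsum_prod]
  refine tsum_congr fun k => ?_
  simp_rw [pow_mul]
  exact (tsum_quadraticChar_three_mul_pow (by positivity) (pow_lt_one₀ h0 h1 k.ne_zero)).symm

lemma summable_lambert {q : ℝ} (h0 : 0 ≤ q) (h1 : q < 1) :
    Summable fun k : ℕ+ => q ^ (k : ℕ) / (1 + q ^ (k : ℕ) + (q ^ (k : ℕ)) ^ 2) := by
  refine Summable.of_nonneg_of_le (fun k => by positivity) (fun k => ?_)
    ((summable_geometric_of_lt_one h0 h1).comp_injective PNat.coe_injective)
  have : 0 ≤ q ^ (k : ℕ) := by positivity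
  refine div_le_self this ?_
  nlinarith

/-- The Lambert series of the cubic theta function. -/
theorem cubicTheta_sub_one {q : ℝ} (h0 : 0 < q) (h1 : q < 1) :
    cubicTheta q - 1 =
      6 * ∑' k : ℕ+, q ^ (k : ℕ) / (1 + q ^ (k : ℕ) + (q ^ (k : ℕ)) ^ 2) := by
  set ν : ℤ × ℤ → ℕ := fun z => (z.1 ^ 2 + z.1 * z.2 + z.2 ^ 2).toNat with hν
  have hν' (z : ℤ × ℤ) : ((ν z : ℕ) : ℤ) = z.1 ^ 2 + z.1 * z.2 + z.2 ^ 2 :=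
    Int.toNat_of_nonneg (by nlinarith [sq_nonneg (z.1 + z.2), sq_nonneg z.1, sq_nonneg z.2])
  have hterm (z : ℤ × ℤ) : q ^ (z.1 ^ 2 + z.1 * z.2 + z.2 ^ 2) = q ^ ν z := by
    rw [← hν', zpow_natCast]
  have hfib (n : ℕ) : {z | ν z = n} = eisensteinReps n := by
    ext z
    rw [mem_eisensteinReps, ← hν', Nat.cast_inj]
    rfl
  have hfin (n : ℕ) : Finite {z // ν z = n} := by
    have := finite_eisensteinReps n
    rw [← hfib] at this
    exact this
  have hcard (n : ℕ) : Nat.card {z // ν z = n} = (eisensteinReps n).ncard := by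
    rw [← hfib]
    rfl
  have hlam := hasSum_divisorCharSum_mul_pow h0.le h1
  have hinner (n : ℕ) : ∑' z : {z // ν z = n}, q ^ ν z = (eisensteinReps n).ncard * q ^ n := by
    have : Fintype {z // ν z = n} := Fintype.ofFinite _
    rw [tsum_fintype, Finset.sum_congr rfl fun z _ => by rw [z.2], Finset.sum_const,
      Finset.card_univ, ← Nat.card_eq_fintype_card, hcard, nsmul_eq_mul]
  have hpos : (fun n : ℕ+ => ((eisensteinReps (n : ℕ)).ncard : ℝ) * q ^ (n : ℕ)) =
      fun n : ℕ+ => 6 * ((divisorCharSum n : ℝ) * q ^ (n : ℕ)) := by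
    funext n
    have := ncard_eisensteinReps n n.ne_zero
    have h' : ((eisensteinReps (n : ℕ)).ncard : ℝ) = 6 * divisorCharSum n := by exact_mod_cast this
    rw [h']
    ring
  have hsum : Summable fun n : ℕ => ((eisensteinReps n).ncard : ℝ) * q ^ n := by
    rw [← summable_pnat_iff_summable_nat, hpos]
    exact hlam.summable.mul_left 6
  have hsig : Summable fun z : Σ n, {z // ν z = n} => q ^ ν z.2 := by
    rw [summable_sigma_of_nonneg fun _ => by positivity]
    refine ⟨fun n => Summable.of_finite, ?_⟩
    simp_rw [hinner]
    exact hsum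
  rw [cubicTheta]
  simp_rw [hterm]
  rw [← (Equiv.sigmaFiberEquiv ν).tsum_eq fun z => q ^ ν z]
  change ∑' z : Σ n, {z // ν z = n}, q ^ ν z.2 - 1 = _
  rw [hsig.tsum_sigma]
  simp_rw [hinner]
  rw [← tsum_zero_pnat_eq_tsum_nat hsum, hpos, tsum_mul_left, hlam.tsum_eq, Nat.cast_zero,
    eisensteinReps_zero]
  simp

lemma abs_log_le_add_rpow {u : ℝ} (hu : 0 < u) : |log u| ≤ u + 2 * u ^ (-(1 / 2) : ℝ) := by
  have h1 : log u ≤ u := (log_le_sub_one_of_pos hu).trans (by linarith)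
  have h2 : log u⁻¹ ≤ u⁻¹ ^ (1 / 2 : ℝ) / (1 / 2) :=
    log_le_rpow_div (inv_nonneg.mpr hu.le) (by norm_num)
  rw [log_inv, inv_rpow hu.le, ← rpow_neg hu.le] at h2
  have h3 : 0 < u ^ (-(1 / 2) : ℝ) := rpow_pos_of_pos hu _
  rw [abs_le]
  constructor <;> linarith

lemma integrableOn_id_mul_exp_neg : IntegrableOn (fun u : ℝ => u * exp (-u)) (Set.Ioi 0) := by
  refine (GammaIntegral_convergent (s := 2) (by norm_num)).congr_fun (fun u _ => ?_)
    measurableSet_Ioi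
  dsimp only
  rw [show (2 - 1 : ℝ) = 1 by norm_num, rpow_one, mul_comm]

lemma integrableOn_abs_log_mul_exp_neg :
    IntegrableOn (fun u : ℝ => |log u| * exp (-u)) (Set.Ioi 0) := by
  have h : IntegrableOn (fun u : ℝ => u * exp (-u) +
      2 * (exp (-u) * u ^ ((1 / 2 : ℝ) - 1))) (Set.Ioi 0) :=
    integrableOn_id_mul_exp_neg.add ((GammaIntegral_convergent (by norm_num)).const_mul 2)
  refine Integrable.mono' h (by fun_prop) ?_
  filter_upwards [ae_restrict_mem measurableSet_Ioi] with u hu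
  rw [norm_mul, norm_of_nonneg (exp_pos _).le, norm_of_nonneg (abs_nonneg _)]
  have := mul_le_mul_of_nonneg_right (abs_log_le_add_rpow hu) (exp_pos (-u)).le
  rw [show (1 / 2 - 1 : ℝ) = -(1 / 2) by norm_num]
  linarith

lemma integral_log_mul_exp_neg :
    ∫ u in Set.Ioi (0 : ℝ), log u * exp (-u) = -eulerMascheroniConstant := by
  have h1 := Complex.hasDerivAt_GammaIntegral (s := 1) (by simp)
  have h2 : HasDerivAt Complex.GammaIntegral (-(eulerMascheroniConstant : ℂ)) 1 := by
    refine Complex.hasDerivAt_Gamma_one.congr_of_eventuallyEq ?_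
    have : IsOpen {z : ℂ | 0 < z.re} := isOpen_lt continuous_const Complex.continuous_re
    filter_upwards [this.mem_nhds (show (1 : ℂ) ∈ {z : ℂ | 0 < z.re} by simp)] with z hz
    exact (Complex.Gamma_eq_integral hz).symm
  have h3 := h1.unique h2
  simp only [sub_self, Complex.cpow_zero, one_mul] at h3
  rw [← Complex.ofReal_inj, ← integral_complex_ofReal]
  push_cast at h3 ⊢
  exact h3

lemma integrableOn_log_mul_exp_neg_mul {m : ℝ} (hm : 0 < m) :
    IntegrableOn (fun u : ℝ => log u * (m * exp (-(m * u)))) (Set.Ioi 0) := by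
  have h0 : IntegrableOn (fun u : ℝ => (log u - log m) * (m * exp (-u))) (Set.Ioi 0) := by
    have h1 : IntegrableOn (fun u : ℝ => log u * exp (-u)) (Set.Ioi 0) := by
      refine Integrable.mono' integrableOn_abs_log_mul_exp_neg (by fun_prop) ?_
      filter_upwards with u
      rw [norm_mul, norm_of_nonneg (exp_pos _).le, norm_eq_abs]
    have h2 : IntegrableOn (fun u : ℝ => exp (-u)) (Set.Ioi 0) := integrableOn_exp_neg_Ioi 0
    have h3 : IntegrableOn (fun u => m * (log u * exp (-u)) - m * log m * exp (-u)) (Set.Ioi 0) :=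
      (h1.const_mul m).sub (h2.const_mul (m * log m))
    exact h3.congr_fun (fun u _ => by ring) measurableSet_Ioi
  have h1 := (integrableOn_Ioi_comp_mul_left_iff
    (fun u : ℝ => (log u - log m) * (m * exp (-u))) 0 hm).2 (by rwa [mul_zero])
  refine h1.congr_fun (fun u hu => ?_) measurableSet_Ioi
  dsimp only
  rw [log_mul hm.ne' (ne_of_gt hu), add_sub_cancel_left]

lemma integral_log_mul_exp_neg_mul {m : ℝ} (hm : 0 < m) :
    ∫ u in Set.Ioi (0 : ℝ), log u * (m * exp (-(m * u))) = -eulerMascheroniConstant - log m := by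
  have h1 : IntegrableOn (fun u : ℝ => log u * exp (-u)) (Set.Ioi 0) := by
    simpa using integrableOn_log_mul_exp_neg_mul one_pos
  have h2 : IntegrableOn (fun u : ℝ => exp (-u)) (Set.Ioi 0) := integrableOn_exp_neg_Ioi 0
  have h := integral_comp_mul_left_Ioi' (fun u : ℝ => (log u - log m) * exp (-u)) 0 hm
  rw [mul_zero] at h
  calc ∫ u in Set.Ioi (0 : ℝ), log u * (m * exp (-(m * u)))
      = m • ∫ u in Set.Ioi (0 : ℝ), (log (m * u) - log m) * exp (-(m * u)) := by
        rw [smul_eq_mul, ← integral_const_mul]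
        refine setIntegral_congr_fun measurableSet_Ioi fun u hu => ?_
        rw [log_mul hm.ne' (ne_of_gt hu), add_sub_cancel_left]
        ring
    _ = ∫ u in Set.Ioi (0 : ℝ), (log u * exp (-u) - log m * exp (-u)) := by
        rw [h]
        simp_rw [sub_mul]
    _ = _ := by
        rw [integral_sub h1 (h2.const_mul _), integral_const_mul, integral_log_mul_exp_neg,
          integral_exp_neg_Ioi_zero, mul_one]

/-- The kernel `1 / (1 + e^u + e^(-u))` of the Lambert series of the cubic theta function. -/
noncomputable def cubicKernel (u : ℝ) : ℝ := exp (-u) / (1 + exp (-u) + exp (-u) ^ 2)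

/-- The negative of the derivative of `cubicKernel`. -/
noncomputable def cubicDensity (u : ℝ) : ℝ :=
  exp (-u) * (1 - exp (-u) ^ 2) / (1 + exp (-u) + exp (-u) ^ 2) ^ 2

lemma hasDerivAt_exp_neg (u : ℝ) : HasDerivAt (fun u : ℝ => exp (-u)) (-exp (-u)) u := by
  simpa using (hasDerivAt_neg u).exp

lemma hasDerivAt_cubicKernel (u : ℝ) : HasDerivAt cubicKernel (-cubicDensity u) u := by
  have hx := hasDerivAt_exp_neg u
  have hpos : 0 < exp (-u) := exp_pos _
  have h := hx.fun_div ((hx.const_add 1).fun_add (hx.fun_pow 2)) (by positivity)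
  refine h.congr_deriv ?_
  unfold cubicDensity
  rw [← neg_div]
  congr 1
  push_cast
  ring

lemma continuous_cubicKernel : Continuous cubicKernel := by
  unfold cubicKernel
  exact Continuous.div (by fun_prop) (by fun_prop) fun u => by positivity

lemma continuous_cubicDensity : Continuous cubicDensity := by
  unfold cubicDensity
  exact Continuous.div (by fun_prop) (by fun_prop) fun u => by positivity

@[fun_prop]
lemma measurable_cubicDensity : Measurable cubicDensity := continuous_cubicDensity.measurable

@[fun_prop]
lemma measurable_cubicKernel : Measurable cubicKernel := continuous_cubicKernel.measurable

lemma cubicKernel_nonneg (u : ℝ) : 0 ≤ cubicKernel u := by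
  unfold cubicKernel
  positivity

lemma cubicKernel_zero : cubicKernel 0 = 1 / 3 := by
  norm_num [cubicKernel]

lemma cubicKernel_le_exp_neg (u : ℝ) : cubicKernel u ≤ exp (-u) := by
  have hpos : 0 < exp (-u) := exp_pos _
  exact div_le_self hpos.le (by nlinarith)

lemma cubicDensity_nonneg {u : ℝ} (hu : 0 ≤ u) : 0 ≤ cubicDensity u := by
  have hpos : 0 < exp (-u) := exp_pos _
  have h1 : exp (-u) ≤ 1 := exp_le_one_iff.mpr (by linarith)
  exact div_nonneg (mul_nonneg hpos.le (by nlinarith)) (by positivity)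

lemma cubicDensity_le_exp_neg (u : ℝ) : cubicDensity u ≤ exp (-u) := by
  have hpos : 0 < exp (-u) := exp_pos _
  unfold cubicDensity
  rw [div_le_iff₀ (by positivity)]
  refine mul_le_mul_of_nonneg_left ?_ hpos.le
  nlinarith [mul_pos hpos hpos, mul_pos hpos (mul_pos hpos hpos)]

lemma abs_cubicDensity_le {u : ℝ} (hu : 0 ≤ u) : |cubicDensity u| ≤ exp (-u) := by
  rw [abs_of_nonneg (cubicDensity_nonneg hu)]
  exact cubicDensity_le_exp_neg u

lemma abs_cubicKernel_sub_le {u : ℝ} (hu : 0 ≤ u) : |cubicKernel u - 1 / 3| ≤ u := by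
  have hpos : 0 < exp (-u) := exp_pos _
  have h1 : exp (-u) ≤ 1 := exp_le_one_iff.mpr (by linarith)
  have h2 : 1 - exp (-u) ≤ u := by linarith [add_one_le_exp (-u)]
  have e : cubicKernel u - 1 / 3 =
      -((1 - exp (-u)) ^ 2 / (3 * (1 + exp (-u) + exp (-u) ^ 2))) := by
    unfold cubicKernel
    field_simp
    ring
  rw [e, abs_neg, abs_of_nonneg (by positivity), div_le_iff₀ (by positivity)]
  nlinarith [mul_nonneg hu hpos.le, mul_nonneg hu (sq_nonneg (exp (-u)))]

lemma tendsto_exp_neg_atTop : Tendsto (fun u : ℝ => exp (-u)) atTop (nhds 0) :=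
  tendsto_exp_atBot.comp tendsto_neg_atTop_atBot

lemma tendsto_cubicKernel_atTop : Tendsto cubicKernel atTop (nhds 0) :=
  squeeze_zero cubicKernel_nonneg cubicKernel_le_exp_neg tendsto_exp_neg_atTop

lemma integrableOn_cubicDensity : IntegrableOn cubicDensity (Set.Ioi 0) := by
  refine Integrable.mono' (integrableOn_exp_neg_Ioi 0) (by fun_prop) ?_
  filter_upwards [ae_restrict_mem measurableSet_Ioi] with u hu
  exact abs_cubicDensity_le (le_of_lt hu)

lemma integral_cubicDensity_Ioi {y : ℝ} (hy : 0 ≤ y) :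
    ∫ u in Set.Ioi y, cubicDensity u = cubicKernel y := by
  have h := integral_Ioi_of_hasDerivAt_of_tendsto' (a := y)
    (fun u _ => (hasDerivAt_cubicKernel u).neg)
    (by simpa using integrableOn_cubicDensity.mono_set (Set.Ioi_subset_Ioi hy))
    tendsto_cubicKernel_atTop.neg
  simpa using h

lemma integrableOn_id_mul_cubicDensity :
    IntegrableOn (fun u => u * cubicDensity u) (Set.Ioi 0) := by
  refine Integrable.mono' integrableOn_id_mul_exp_neg (by fun_prop) ?_
  filter_upwards [ae_restrict_mem measurableSet_Ioi] with u hu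
  rw [norm_mul, norm_of_nonneg (le_of_lt hu)]
  exact mul_le_mul_of_nonneg_left (abs_cubicDensity_le (le_of_lt hu)) (le_of_lt hu)

lemma integrableOn_abs_log_mul_cubicDensity :
    IntegrableOn (fun u => |log u| * cubicDensity u) (Set.Ioi 0) := by
  refine Integrable.mono' integrableOn_abs_log_mul_exp_neg (by fun_prop) ?_
  filter_upwards [ae_restrict_mem measurableSet_Ioi] with u hu
  rw [norm_mul, norm_of_nonneg (abs_nonneg _)]
  exact mul_le_mul_of_nonneg_left (abs_cubicDensity_le (le_of_lt hu)) (abs_nonneg _)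

lemma integrableOn_log_mul_cubicDensity :
    IntegrableOn (fun u => log u * cubicDensity u) (Set.Ioi 0) := by
  refine Integrable.mono' integrableOn_abs_log_mul_cubicDensity (by fun_prop) ?_
  filter_upwards [ae_restrict_mem measurableSet_Ioi] with u hu
  rw [norm_mul, norm_of_nonneg (cubicDensity_nonneg (le_of_lt hu)), norm_eq_abs]

lemma integral_id_mul_cubicDensity :
    ∫ u in Set.Ioi (0 : ℝ), u * cubicDensity u = π / (3 * √3) := by
  have h3 : √3 ^ 2 = 3 := sq_sqrt (by norm_num)
  have h3pos : 0 < √3 := by positivity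
  have hderiv (u : ℝ) : HasDerivAt
      (fun u => -(u * cubicKernel u) - 2 / √3 * arctan ((2 * exp (-u) + 1) / √3))
      (u * cubicDensity u) u := by
    have hx := hasDerivAt_exp_neg u
    have hpos : 0 < exp (-u) := exp_pos _
    have h := (((hasDerivAt_id' u).fun_mul (hasDerivAt_cubicKernel u)).fun_neg).fun_sub
      ((((hx.const_mul 2).add_const 1).div_const √3).arctan.const_mul (2 / √3))
    refine h.congr_deriv ?_
    unfold cubicKernel
    have e : 1 + ((2 * exp (-u) + 1) / √3) ^ 2 = 4 * (1 + exp (-u) + exp (-u) ^ 2) / 3 := by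
      rw [div_pow, h3]
      ring
    rw [e]
    field_simp
    rw [h3]
    ring
  have hlim : Tendsto
      (fun u => -(u * cubicKernel u) - 2 / √3 * arctan ((2 * exp (-u) + 1) / √3)) atTop
      (nhds (-0 - 2 / √3 * arctan ((2 * 0 + 1) / √3))) := by
    refine Tendsto.sub (Tendsto.neg ?_) (Tendsto.const_mul _ ?_)
    · refine squeeze_zero' ?_ ?_ (by simpa using tendsto_pow_mul_exp_neg_atTop_nhds_zero 1)
      · filter_upwards [eventually_ge_atTop 0] with u hu
        exact mul_nonneg hu (cubicKernel_nonneg u)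
      · filter_upwards [eventually_ge_atTop 0] with u hu
        exact mul_le_mul_of_nonneg_left (cubicKernel_le_exp_neg u) hu
    · exact (continuous_arctan.tendsto _).comp
        (((tendsto_exp_neg_atTop.const_mul 2).add_const 1).div_const √3)
  have h := integral_Ioi_of_hasDerivAt_of_tendsto' (a := 0) (fun u _ => hderiv u)
    integrableOn_id_mul_cubicDensity hlim
  rw [h]
  have a1 : arctan ((2 * 0 + 1) / √3) = π / 6 := by
    rw [mul_zero, zero_add, ← tan_pi_div_six]
    exact arctan_tan (by linarith [pi_pos]) (by linarith [pi_pos])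
  have a2 : arctan ((2 * exp (-0) + 1) / √3) = π / 3 := by
    have : (2 * exp (-0) + 1) / √3 = tan (π / 3) := by
      rw [tan_pi_div_three, neg_zero, exp_zero, div_eq_iff h3pos.ne', ← sq, h3]
      norm_num
    rw [this]
    exact arctan_tan (by linarith [pi_pos]) (by linarith [pi_pos])
  rw [a1, a2]
  field_simp
  ring

lemma sum_exp_sub_exp_eq (n : ℕ) (u : ℝ) :
    ∑ j ∈ Finset.range n, ((3 * j + 1) * exp (-((3 * j + 1) * u)) -
      (3 * j + 2) * exp (-((3 * j + 2) * u))) =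
    cubicDensity u * (1 - exp (-(3 * n * u))) - 3 * n * exp (-(3 * n * u)) * cubicKernel u := by
  have hpow (m : ℕ) : exp (-(m * u)) = exp (-u) ^ m := by rw [← exp_nat_mul]; ring_nf
  have h3 (m : ℕ) : exp (-(3 * m * u)) = (exp (-u) ^ m) ^ 3 := by
    rw [← pow_mul, ← hpow]; push_cast; ring_nf
  have h1 (m : ℕ) : exp (-((3 * m + 1) * u)) = (exp (-u) ^ m) ^ 3 * exp (-u) := by
    rw [← h3, ← exp_add]; ring_nf
  have h2 (m : ℕ) : exp (-((3 * m + 2) * u)) = (exp (-u) ^ m) ^ 3 * exp (-u) ^ 2 := by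
    rw [← h3, sq, ← exp_add, ← exp_add]; ring_nf
  induction n with
  | zero => simp
  | succ n ih =>
    have hpos : 0 < exp (-u) := exp_pos _
    rw [Finset.sum_range_succ, ih, h1, h2, h3, h3, pow_succ (exp (-u)) n]
    unfold cubicKernel cubicDensity
    generalize exp (-u) ^ n = y
    generalize exp (-u) = x at *
    push_cast
    field_simp
    ring

lemma sum_log_sub_log_eq_integral (n : ℕ) :
    ∑ j ∈ Finset.range n, (log (3 * j + 2) - log (3 * j + 1)) =
      ∫ u in Set.Ioi (0 : ℝ), log u * (cubicDensity u * (1 - exp (-(3 * n * u))) -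
        3 * n * exp (-(3 * n * u)) * cubicKernel u) := by
  simp_rw [← sum_exp_sub_exp_eq, Finset.mul_sum, mul_sub]
  have h1 (j : ℕ) := integrableOn_log_mul_exp_neg_mul (m := 3 * j + 1) (by positivity)
  have h2 (j : ℕ) := integrableOn_log_mul_exp_neg_mul (m := 3 * j + 2) (by positivity)
  rw [integral_finsetSum]
  swap
  · exact fun j _ => (h1 j).sub (h2 j)
  refine Finset.sum_congr rfl fun j _ => ?_
  rw [integral_sub (h1 j) (h2 j), integral_log_mul_exp_neg_mul (by positivity),
    integral_log_mul_exp_neg_mul (by positivity)]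
  ring

lemma integrableOn_log_mul_exp_neg : IntegrableOn (fun u : ℝ => log u * exp (-u)) (Set.Ioi 0) := by
  simpa using integrableOn_log_mul_exp_neg_mul one_pos

lemma tendsto_integral_log_mul_exp_neg_mul_cubicKernel :
    Tendsto (fun m : ℝ => ∫ v in Set.Ioi (0 : ℝ), log v * exp (-v) * cubicKernel (v / m)) atTop
      (nhds (-eulerMascheroniConstant / 3)) := by
  have h : -eulerMascheroniConstant / 3 =
      ∫ v in Set.Ioi (0 : ℝ), log v * exp (-v) * (1 / 3) := by
    rw [integral_mul_const, integral_log_mul_exp_neg]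
    ring
  rw [h]
  refine tendsto_integral_filter_of_dominated_convergence (fun v => |log v| * exp (-v)) ?_ ?_
    integrableOn_abs_log_mul_exp_neg ?_
  · exact Eventually.of_forall fun m => by fun_prop
  · filter_upwards [eventually_gt_atTop 0] with m hm
    filter_upwards [ae_restrict_mem measurableSet_Ioi] with v hv
    have hvm : 0 ≤ v / m := div_nonneg (le_of_lt hv) hm.le
    rw [norm_mul, norm_mul, norm_of_nonneg (exp_pos _).le, norm_eq_abs,
      norm_of_nonneg (cubicKernel_nonneg _)]
    refine mul_le_of_le_one_right (by positivity) ?_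
    exact (cubicKernel_le_exp_neg _).trans (exp_le_one_iff.mpr (by linarith))
  · filter_upwards with v
    refine Tendsto.const_mul _ ?_
    rw [← cubicKernel_zero]
    exact (continuous_cubicKernel.tendsto 0).comp (tendsto_const_nhds.div_atTop tendsto_id)

lemma tendsto_log_mul_integral_exp_neg_mul_cubicKernel :
    Tendsto (fun m : ℝ => log m *
      ∫ v in Set.Ioi (0 : ℝ), exp (-v) * (cubicKernel (v / m) - 1 / 3)) atTop (nhds 0) := by
  set K := ∫ v in Set.Ioi (0 : ℝ), v * exp (-v) with hK
  have hlim : Tendsto (fun m : ℝ => log m / m * K) atTop (nhds 0) := by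
    have := (isLittleO_log_id_atTop.tendsto_div_nhds_zero).mul_const K
    simpa using this
  refine squeeze_zero_norm' ?_ hlim
  filter_upwards [eventually_ge_atTop 1] with m hm
  have hm0 : 0 < m := by linarith
  rw [norm_mul, norm_of_nonneg (log_nonneg hm), div_mul_eq_mul_div, mul_div_assoc]
  refine mul_le_mul_of_nonneg_left ?_ (log_nonneg hm)
  rw [hK, ← integral_div]
  refine norm_integral_le_of_norm_le (integrableOn_id_mul_exp_neg.div_const m) ?_
  filter_upwards [ae_restrict_mem measurableSet_Ioi] with v hv
  rw [norm_mul, norm_of_nonneg (exp_pos _).le, norm_eq_abs]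
  have := abs_cubicKernel_sub_le (div_nonneg (le_of_lt hv) hm0.le)
  calc exp (-v) * |cubicKernel (v / m) - 1 / 3| ≤ exp (-v) * (v / m) :=
        mul_le_mul_of_nonneg_left this (exp_pos _).le
    _ = v * exp (-v) / m := by ring

lemma integral_log_mul_scaled_kernel {m : ℝ} (hm : 0 < m) :
    ∫ u in Set.Ioi (0 : ℝ), log u * (m * exp (-(m * u)) * cubicKernel u) =
      (∫ v in Set.Ioi (0 : ℝ), log v * exp (-v) * cubicKernel (v / m)) -
        log m * (∫ v in Set.Ioi (0 : ℝ), exp (-v) * (cubicKernel (v / m) - 1 / 3)) -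
        log m / 3 := by
  have hb (f : ℝ → ℝ) (hf : IntegrableOn f (Set.Ioi 0)) :
      IntegrableOn (fun v => f v * cubicKernel (v / m)) (Set.Ioi 0) := by
    refine Integrable.mul_bdd (c := 1) hf
      (measurable_cubicKernel.comp (measurable_id.div_const m)).aestronglyMeasurable ?_
    filter_upwards [ae_restrict_mem measurableSet_Ioi] with v hv
    rw [norm_of_nonneg (cubicKernel_nonneg _)]
    refine (cubicKernel_le_exp_neg _).trans (exp_le_one_iff.mpr ?_)
    have := div_nonneg (le_of_lt hv) hm.le
    linarith
  have h1 := hb _ integrableOn_log_mul_exp_neg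
  have h2 := hb _ (integrableOn_exp_neg_Ioi 0)
  have h3 : IntegrableOn (fun v : ℝ => exp (-v) * (1 / 3)) (Set.Ioi 0) :=
    (integrableOn_exp_neg_Ioi 0).mul_const _
  have h := integral_comp_mul_left_Ioi'
    (fun v : ℝ => (log v - log m) * exp (-v) * cubicKernel (v / m)) 0 hm
  rw [mul_zero] at h
  calc ∫ u in Set.Ioi (0 : ℝ), log u * (m * exp (-(m * u)) * cubicKernel u)
      = m • ∫ u in Set.Ioi (0 : ℝ),
          (log (m * u) - log m) * exp (-(m * u)) * cubicKernel (m * u / m) := by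
        rw [smul_eq_mul, ← integral_const_mul]
        refine setIntegral_congr_fun measurableSet_Ioi fun u hu => ?_
        rw [log_mul hm.ne' (ne_of_gt hu), add_sub_cancel_left, mul_div_cancel_left₀ _ hm.ne']
        ring
    _ = ∫ v in Set.Ioi (0 : ℝ), (log v * exp (-v) * cubicKernel (v / m) -
          log m * (exp (-v) * cubicKernel (v / m))) := by
        rw [h]
        congr 1
        funext v
        ring
    _ = _ := by
        rw [integral_sub h1 (h2.const_mul _), integral_const_mul]
        simp_rw [mul_sub]
        rw [integral_sub h2 h3, integral_mul_const, integral_exp_neg_Ioi_zero]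
        ring

lemma tendsto_sum_log_sub_log :
    Tendsto (fun n : ℕ => ∑ j ∈ Finset.range n, (log (3 * j + 2) - log (3 * j + 1)) -
      log (3 * n) / 3) atTop
      (nhds ((∫ u in Set.Ioi (0 : ℝ), log u * cubicDensity u) + eulerMascheroniConstant / 3)) := by
  have hatTop : Tendsto (fun n : ℕ => (3 * n : ℝ)) atTop atTop :=
    tendsto_natCast_atTop_atTop.const_mul_atTop (by norm_num)
  have hdct : Tendsto (fun n : ℕ => ∫ u in Set.Ioi (0 : ℝ),
      log u * cubicDensity u * (1 - exp (-(3 * n * u)))) atTop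
      (nhds (∫ u in Set.Ioi (0 : ℝ), log u * cubicDensity u)) := by
    refine tendsto_integral_of_dominated_convergence (fun u => |log u| * cubicDensity u) ?_
      integrableOn_abs_log_mul_cubicDensity ?_ ?_
    · exact fun n => by fun_prop
    · intro n
      filter_upwards [ae_restrict_mem measurableSet_Ioi] with u hu
      have hu' : 0 < u := hu
      have h1 : exp (-(3 * n * u)) ≤ 1 := exp_le_one_iff.mpr (by
        have : 0 ≤ 3 * n * u := by positivity
        linarith)
      rw [norm_mul, norm_mul, norm_eq_abs, norm_of_nonneg (cubicDensity_nonneg hu'.le),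
        norm_of_nonneg (by linarith)]
      refine mul_le_of_le_one_right (mul_nonneg (abs_nonneg _) (cubicDensity_nonneg hu'.le)) ?_
      linarith [exp_pos (-(3 * n * u))]
    · filter_upwards [ae_restrict_mem measurableSet_Ioi] with u hu
      have h := tendsto_exp_neg_atTop.comp (hatTop.atTop_mul_const (show 0 < u from hu))
      simpa using (h.const_sub 1).const_mul (log u * cubicDensity u)
  have hk := (tendsto_integral_log_mul_exp_neg_mul_cubicKernel.sub
    tendsto_log_mul_integral_exp_neg_mul_cubicKernel).comp hatTop
  have hlim := hdct.sub hk
  have e : (∫ u in Set.Ioi (0 : ℝ), log u * cubicDensity u) -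
      (-eulerMascheroniConstant / 3 - 0) =
      (∫ u in Set.Ioi (0 : ℝ), log u * cubicDensity u) + eulerMascheroniConstant / 3 := by ring
  rw [e] at hlim
  refine hlim.congr' ?_
  filter_upwards [eventually_gt_atTop 0] with n hn
  have hn' : (0 : ℝ) < 3 * n := by positivity
  have h1 : IntegrableOn (fun u => log u * cubicDensity u * (1 - exp (-(3 * n * u))))
      (Set.Ioi 0) := by
    refine Integrable.mul_bdd (c := 1) integrableOn_log_mul_cubicDensity (by fun_prop) ?_
    filter_upwards [ae_restrict_mem measurableSet_Ioi] with u hu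
    have : 0 < 3 * n * u := mul_pos hn' hu
    have h1 : exp (-(3 * n * u)) ≤ 1 := exp_le_one_iff.mpr (by linarith)
    rw [norm_of_nonneg (by linarith)]
    linarith [exp_pos (-(3 * n * u))]
  have h2 : IntegrableOn (fun u => log u * (3 * n * exp (-(3 * n * u)) * cubicKernel u))
      (Set.Ioi 0) := by
    have : IntegrableOn (fun u => log u * (3 * n * exp (-(3 * n * u))) * cubicKernel u)
        (Set.Ioi 0) := by
      refine Integrable.mul_bdd (c := 1) (integrableOn_log_mul_exp_neg_mul hn') (by fun_prop) ?_
      filter_upwards [ae_restrict_mem measurableSet_Ioi] with u hu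
      rw [norm_of_nonneg (cubicKernel_nonneg _)]
      refine (cubicKernel_le_exp_neg _).trans (exp_le_one_iff.mpr ?_)
      linarith [Set.mem_Ioi.mp hu]
    exact this.congr_fun (fun u _ => by ring) measurableSet_Ioi
  rw [sum_log_sub_log_eq_integral]
  simp_rw [mul_sub (log _), ← mul_assoc (log _) (cubicDensity _)]
  rw [integral_sub h1 h2, integral_log_mul_scaled_kernel hn']
  simp only [Function.comp_apply]
  ring

/-- The logarithmic moment of `cubicDensity`. -/
theorem integral_log_mul_cubicDensity :
    ∫ u in Set.Ioi (0 : ℝ), log u * cubicDensity u =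
      log (Gamma (1 / 3)) - log (Gamma (2 / 3)) - log 3 / 3 - eulerMascheroniConstant / 3 := by
  have hG := (BohrMollerup.tendsto_log_gamma (x := 1 / 3) (by norm_num)).sub
    (BohrMollerup.tendsto_log_gamma (x := 2 / 3) (by norm_num))
  have hW := tendsto_sum_log_sub_log.comp (tendsto_add_atTop_nat 1)
  have hlog : Tendsto (fun n : ℕ => log ((n + 1 : ℕ) / n) / 3) atTop (nhds 0) := by
    have h1 : Tendsto (fun n : ℕ => ((n + 1 : ℕ) / n : ℝ)) atTop (nhds 1) := by
      have : Tendsto (fun n : ℕ => 1 + 1 / (n : ℝ)) atTop (nhds (1 + 0)) :=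
        tendsto_one_div_atTop_nhds_zero_nat.const_add 1
      rw [add_zero] at this
      refine this.congr' ?_
      filter_upwards [eventually_gt_atTop 0] with n hn
      have : (0 : ℝ) < n := by exact_mod_cast hn
      push_cast
      field_simp
    have := ((continuousAt_log one_ne_zero).tendsto.comp h1).div_const 3
    simpa using this
  have h := (hG.sub hW).sub hlog
  have hconst : Tendsto (fun _ : ℕ => log 3 / 3) atTop (nhds (log (Gamma (1 / 3)) -
      log (Gamma (2 / 3)) - ((∫ u in Set.Ioi (0 : ℝ), log u * cubicDensity u) +
        eulerMascheroniConstant / 3) - 0)) := by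
    refine h.congr' ?_
    filter_upwards [eventually_gt_atTop 0] with n hn
    have hn' : (0 : ℝ) < n := by exact_mod_cast hn
    have hsplit (c : ℝ) (hc : 0 < c) (j : ℕ) : log (c / 3 + j) = log (3 * j + c) - log 3 := by
      rw [← log_div (by positivity) (by norm_num)]
      congr 1
      ring
    have hn1 : ((n + 1 : ℕ) : ℝ) ≠ 0 := by positivity
    simp only [BohrMollerup.logGammaSeq, Function.comp_apply, Finset.sum_sub_distrib,
      hsplit 1 one_pos, hsplit 2 two_pos]
    rw [log_div hn1 hn'.ne', log_mul (by norm_num) hn1]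
    ring
  have := tendsto_nhds_unique hconst tendsto_const_nhds
  linarith

/-- The defect `X - ∑_{1 ≤ k ≤ X} log (X / k)`. -/
noncomputable def logSumDefect (X : ℝ) : ℝ :=
  X - (⌊X⌋₊ * log X - log (⌊X⌋₊.factorial))

@[fun_prop]
lemma measurable_logSumDefect : Measurable logSumDefect := by
  have h1 : Measurable fun X : ℝ => ((⌊X⌋₊ : ℕ) : ℝ) :=
    (measurable_from_nat (f := fun n : ℕ => (n : ℝ))).comp Nat.measurable_floor
  have h2 : Measurable fun X : ℝ => log (⌊X⌋₊.factorial) :=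
    (measurable_from_nat (f := fun n : ℕ => log (n.factorial))).comp Nat.measurable_floor
  exact measurable_id.sub ((h1.mul measurable_log).sub h2)

lemma logSumDefect_of_lt_one {X : ℝ} (h1 : X < 1) : logSumDefect X = X := by
  simp [logSumDefect, Nat.floor_eq_zero.mpr h1]

lemma abs_logSumDefect_sub_le {X : ℝ} (hX : 1 ≤ X) :
    |logSumDefect X - log X / 2 - (log (Stirling.stirlingSeq ⌊X⌋₊) + log 2 / 2)| ≤ 1 / X := by
  have hX0 : 0 < X := by linarith
  have hn1 : 1 ≤ ⌊X⌋₊ := (Nat.one_le_floor_iff X).mpr hX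
  have hle : (⌊X⌋₊ : ℝ) ≤ X := Nat.floor_le hX0.le
  have hlt : X < ⌊X⌋₊ + 1 := Nat.lt_floor_add_one X
  have hn : (1 : ℝ) ≤ (⌊X⌋₊ : ℝ) := by exact_mod_cast hn1
  rw [Stirling.log_stirlingSeq_formula]
  unfold logSumDefect
  generalize log (⌊X⌋₊.factorial : ℝ) = F
  generalize (⌊X⌋₊ : ℝ) = n at *
  have hn0 : 0 < n := by linarith
  rw [log_mul two_ne_zero hn0.ne', log_div hn0.ne' (exp_pos 1).ne', log_exp]
  have hlow : 1 - n / X ≤ log X - log n := by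
    have := one_sub_inv_le_log_of_pos (div_pos hX0 hn0)
    rwa [inv_div, log_div hX0.ne' hn0.ne'] at this
  have hup : log X - log n ≤ X / n - 1 := by
    have := log_le_sub_one_of_pos (div_pos hX0 hn0)
    rwa [log_div hX0.ne' hn0.ne'] at this
  generalize log X = x at *
  generalize log n = y at *
  have e1 : n * (x - y) ≤ X - n := by
    calc n * (x - y) ≤ n * (X / n - 1) := by gcongr
      _ = X - n := by field_simp
  have e2 : X - n - n * (x - y) ≤ 1 / X := by
    have h : n * (1 - n / X) ≤ n * (x - y) := by gcongr
    have h' : X - n - n * (1 - n / X) = (X - n) ^ 2 / X := by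
      field_simp
    have h'' : (X - n) ^ 2 / X ≤ 1 / X := by
      gcongr
      nlinarith
    linarith
  have e3 : 0 ≤ x - y := by
    have : n / X ≤ 1 := (div_le_one hX0).mpr hle
    linarith
  have e4 : (x - y) / 2 ≤ 1 / X := by
    have : X / n - 1 ≤ 2 / X := by
      rw [div_sub_one hn0.ne', div_le_div_iff₀ hn0 hX0]
      nlinarith
    have h2 : (2 : ℝ) / X = 2 * (1 / X) := by ring
    linarith
  rw [abs_le]
  constructor <;> linarith

lemma tendsto_log_stirlingSeq_add :
    Tendsto (fun n : ℕ => log (Stirling.stirlingSeq n) + log 2 / 2) atTop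
      (nhds (log (2 * π) / 2)) := by
  have h := ((Stirling.tendsto_stirlingSeq_sqrt_pi).log
    (sqrt_pos.mpr pi_pos).ne').add_const (log 2 / 2)
  convert h using 2
  rw [log_sqrt pi_pos.le, log_mul two_ne_zero pi_ne_zero]
  ring

lemma tendsto_logSumDefect_sub :
    Tendsto (fun X => logSumDefect X - log X / 2) atTop (nhds (log (2 * π) / 2)) := by
  have h1 : Tendsto (fun X => logSumDefect X - log X / 2 -
      (log (Stirling.stirlingSeq ⌊X⌋₊) + log 2 / 2)) atTop (nhds 0) := by
    refine squeeze_zero_norm' (a := fun X : ℝ => 1 / X) ?_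
      (tendsto_const_nhds.div_atTop tendsto_id)
    filter_upwards [eventually_ge_atTop 1] with X hX using abs_logSumDefect_sub_le hX
  have h2 := tendsto_log_stirlingSeq_add.comp (tendsto_nat_floor_atTop (α := ℝ))
  simpa using h1.add h2

lemma exists_abs_logSumDefect_sub_le :
    ∃ C : ℝ, ∀ X : ℝ, 1 ≤ X → |logSumDefect X - log X / 2| ≤ C := by
  obtain ⟨C, hC⟩ :=
    (Metric.isBounded_range_of_tendsto _ tendsto_log_stirlingSeq_add).exists_norm_le
  refine ⟨1 + C, fun X hX => ?_⟩
  have h1 := abs_logSumDefect_sub_le hX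
  have h2 := hC _ ⟨⌊X⌋₊, rfl⟩
  have h3 : 1 / X ≤ 1 := (div_le_one (by linarith)).mpr hX
  rw [norm_eq_abs] at h2
  rw [abs_le] at *
  constructor <;> linarith [h1.1, h1.2, h2.1, h2.2]

lemma exists_abs_logSumDefect_mul_le :
    ∃ C : ℝ, ∀ v Λ : ℝ, 0 < v → 1 ≤ Λ →
      |logSumDefect (v * Λ) - log (v * Λ) / 2| ≤ C + |log v| := by
  obtain ⟨C, hC⟩ := exists_abs_logSumDefect_sub_le
  have hC0 : 0 ≤ C := (abs_nonneg _).trans (hC 1 le_rfl)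
  refine ⟨C + 1, fun v Λ hv hΛ => ?_⟩
  rcases le_or_gt 1 (v * Λ) with h | h
  · linarith [hC _ h, abs_nonneg (log v)]
  · have hpos : 0 < v * Λ := by positivity
    have h1 : log (v * Λ) ≤ 0 := log_nonpos hpos.le h.le
    have h2 : log v ≤ log (v * Λ) := log_le_log hv (by nlinarith)
    have h3 := neg_abs_le (log v)
    rw [logSumDefect_of_lt_one h, abs_le]
    constructor <;> linarith

lemma integrableOn_cubicDensity_mul_logSumDefect_sub {Λ : ℝ} (hΛ : 1 ≤ Λ) :
    IntegrableOn (fun v => cubicDensity v * (logSumDefect (v * Λ) - log (v * Λ) / 2))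
      (Set.Ioi 0) := by
  obtain ⟨C, hC⟩ := exists_abs_logSumDefect_mul_le
  refine Integrable.mono' ((integrableOn_cubicDensity.const_mul C).add
    integrableOn_abs_log_mul_cubicDensity) (by fun_prop) ?_
  filter_upwards [ae_restrict_mem measurableSet_Ioi] with v hv
  have h0 := cubicDensity_nonneg (le_of_lt hv)
  rw [norm_mul, norm_of_nonneg h0, norm_eq_abs]
  calc _ ≤ cubicDensity v * (C + |log v|) := by gcongr; exact hC v Λ hv hΛ
    _ = _ := by simp only [Pi.add_apply]; ring

lemma tendsto_integral_cubicDensity_mul_logSumDefect_sub :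
    Tendsto (fun Λ => ∫ v in Set.Ioi (0 : ℝ),
      cubicDensity v * (logSumDefect (v * Λ) - log (v * Λ) / 2)) atTop
      (nhds (log (2 * π) / 6)) := by
  have h : log (2 * π) / 6 = ∫ v in Set.Ioi (0 : ℝ), cubicDensity v * (log (2 * π) / 2) := by
    rw [integral_mul_const, integral_cubicDensity_Ioi le_rfl, cubicKernel_zero]
    ring
  rw [h]
  obtain ⟨C, hC⟩ := exists_abs_logSumDefect_mul_le
  refine tendsto_integral_filter_of_dominated_convergence
    (fun v => C * cubicDensity v + |log v| * cubicDensity v) ?_ ?_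
    ((integrableOn_cubicDensity.const_mul C).add integrableOn_abs_log_mul_cubicDensity) ?_
  · exact Eventually.of_forall fun Λ => by fun_prop
  · filter_upwards [eventually_ge_atTop 1] with Λ hΛ
    filter_upwards [ae_restrict_mem measurableSet_Ioi] with v hv
    have h0 := cubicDensity_nonneg (le_of_lt hv)
    rw [norm_mul, norm_of_nonneg h0, norm_eq_abs]
    calc _ ≤ cubicDensity v * (C + |log v|) := by gcongr; exact hC v Λ hv hΛ
      _ = _ := by ring
  · filter_upwards [ae_restrict_mem measurableSet_Ioi] with v hv
    exact (tendsto_logSumDefect_sub.comp (tendsto_id.const_mul_atTop hv)).const_mul _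

lemma sum_log_sub_log_succ (x : ℝ) (m : ℕ) :
    ∑ i ∈ Finset.range m, (x - log (i + 1)) = m * x - log m.factorial := by
  induction m with
  | zero => simp
  | succ m ih =>
    have : (m.factorial : ℝ) ≠ 0 := by exact_mod_cast m.factorial_ne_zero
    rw [Finset.sum_range_succ, ih, Nat.factorial_succ, Nat.cast_mul,
      log_mul (by positivity) this]
    push_cast
    ring

lemma log_sub_log_succ_nonneg {X : ℝ} (hX : 0 < X) {i : ℕ} (hi : i ∈ Finset.range ⌊X⌋₊) :
    0 ≤ log X - log (i + 1) := by
  have h : ((i + 1 : ℕ) : ℝ) ≤ X := (Nat.le_floor_iff hX.le).mp (Finset.mem_range.mp hi)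
  push_cast at h
  exact sub_nonneg.mpr (log_le_log (by positivity) h)

lemma sub_logSumDefect (X : ℝ) :
    X - logSumDefect X = ∑ i ∈ Finset.range ⌊X⌋₊, (log X - log (i + 1)) := by
  rw [sum_log_sub_log_succ, logSumDefect]
  ring

lemma logSumDefect_le {X : ℝ} (hX : 0 < X) : logSumDefect X ≤ X := by
  rw [← sub_nonneg, sub_logSumDefect]
  exact Finset.sum_nonneg fun i hi => log_sub_log_succ_nonneg hX hi

lemma tsum_ofReal_log_div {X : ℝ} (hX : 0 < X) :
    ∑' k : ℕ+, ENNReal.ofReal (log (X / (k : ℕ))) = ENNReal.ofReal (X - logSumDefect X) := by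
  rw [tsum_pnat_eq_tsum_succ (f := fun k : ℕ => ENNReal.ofReal (log (X / k))),
    tsum_eq_sum (s := Finset.range ⌊X⌋₊)]
  · rw [sub_logSumDefect, ENNReal.ofReal_sum_of_nonneg fun i => log_sub_log_succ_nonneg hX]
    refine Finset.sum_congr rfl fun i _ => ?_
    push_cast
    rw [log_div hX.ne' (by positivity)]
  · intro i hi
    rw [Finset.mem_range, not_lt] at hi
    have h1 : X < i + 1 := by
      have := Nat.lt_floor_add_one X
      have h2 : (⌊X⌋₊ : ℝ) ≤ i := by exact_mod_cast hi
      linarith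
    rw [ENNReal.ofReal_eq_zero]
    push_cast
    exact log_nonpos (by positivity) ((div_le_one (by positivity)).mpr h1.le)

lemma lintegral_one_div_Ioo {b c : ℝ} (hb : 0 < b) (hc : 0 < c) :
    ∫⁻ s in Set.Ioo b c, ENNReal.ofReal (1 / s) = ENNReal.ofReal (log (c / b)) := by
  rcases le_or_gt c b with h | h
  · rw [Set.Ioo_eq_empty (not_lt.mpr h), Measure.restrict_empty, lintegral_zero_measure,
      ENNReal.ofReal_of_nonpos (log_nonpos (by positivity) ((div_le_one hb).mpr h))]
  · have hi : IntegrableOn (fun s : ℝ => 1 / s) (Set.Ioo b c) := by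
      refine (ContinuousOn.integrableOn_Icc ?_).mono_set Set.Ioo_subset_Icc_self
      exact continuousOn_const.div continuousOn_id fun s hs => (hb.trans_le hs.1).ne'
    rw [← ofReal_integral_eq_lintegral_ofReal hi, ← integral_Ioc_eq_integral_Ioo,
      ← intervalIntegral.integral_of_le h.le, integral_one_div_of_pos hb hc]
    filter_upwards [ae_restrict_mem measurableSet_Ioo] with s hs
    exact one_div_nonneg.mpr (hb.trans hs.1).le

lemma lintegral_cubicDensity_Ioi {y : ℝ} (hy : 0 ≤ y) :
    ∫⁻ v in Set.Ioi y, ENNReal.ofReal (cubicDensity v) = ENNReal.ofReal (cubicKernel y) := by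
  rw [← integral_cubicDensity_Ioi hy, ofReal_integral_eq_lintegral_ofReal
    (integrableOn_cubicDensity.mono_set (Set.Ioi_subset_Ioi hy))]
  filter_upwards [ae_restrict_mem measurableSet_Ioi] with v hv
  exact cubicDensity_nonneg (hy.trans (le_of_lt hv))

lemma lintegral_one_div_mul_cubicKernel {b c : ℝ} (hb : 0 < b) (hc : 0 < c) :
    ∫⁻ s in Set.Ioo 0 c, ENNReal.ofReal (1 / s * cubicKernel (b / s)) =
      ∫⁻ v in Set.Ioi 0, ENNReal.ofReal (cubicDensity v) * ENNReal.ofReal (log (c * v / b)) := by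
  set h : ℝ → ℝ → ENNReal := fun s v =>
    if b < s * v then ENNReal.ofReal (1 / s) * ENNReal.ofReal (cubicDensity v) else 0 with hh
  have hmeas : Measurable (Function.uncurry h) := by
    refine Measurable.ite (measurableSet_lt measurable_const
      (measurable_fst.mul measurable_snd)) ?_ measurable_const
    fun_prop
  have h1 : ∫⁻ s in Set.Ioo 0 c, ENNReal.ofReal (1 / s * cubicKernel (b / s)) =
      ∫⁻ s in Set.Ioo 0 c, ∫⁻ v in Set.Ioi 0, h s v := by
    refine setLIntegral_congr_fun measurableSet_Ioo fun s hs => ?_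
    have hs0 : 0 < s := hs.1
    have : h s = (Set.Ioi (b / s)).indicator
        fun v => ENNReal.ofReal (1 / s) * ENNReal.ofReal (cubicDensity v) := by
      ext v
      simp [hh, Set.indicator_apply, div_lt_iff₀ hs0, mul_comm]
    have hsub : Set.Ioi (b / s) ∩ Set.Ioi 0 = Set.Ioi (b / s) :=
      Set.inter_eq_left.mpr (Set.Ioi_subset_Ioi (by positivity))
    simp only [this]
    rw [setLIntegral_indicator measurableSet_Ioi, hsub, lintegral_const_mul _ (by fun_prop),
      lintegral_cubicDensity_Ioi (by positivity), ENNReal.ofReal_mul (by positivity)]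
  have h2 : ∫⁻ v in Set.Ioi 0, ENNReal.ofReal (cubicDensity v) *
      ENNReal.ofReal (log (c * v / b)) = ∫⁻ v in Set.Ioi 0, ∫⁻ s in Set.Ioo 0 c, h s v := by
    refine setLIntegral_congr_fun measurableSet_Ioi fun v hv => ?_
    have hv0 : 0 < v := hv
    have : (fun s => h s v) = (Set.Ioi (b / v)).indicator
        fun s => ENNReal.ofReal (cubicDensity v) * ENNReal.ofReal (1 / s) := by
      ext s
      simp [hh, Set.indicator_apply, div_lt_iff₀ hv0, mul_comm]
    have hbv : 0 < b / v := by positivity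
    have hsub : Set.Ioi (b / v) ∩ Set.Ioo 0 c = Set.Ioo (b / v) c := by
      ext s
      simp only [Set.mem_inter_iff, Set.mem_Ioi, Set.mem_Ioo]
      exact ⟨fun h => ⟨h.1, h.2.2⟩, fun h => ⟨h.1, hbv.trans h.1, h.2⟩⟩
    simp only [this]
    rw [setLIntegral_indicator measurableSet_Ioi, hsub, lintegral_const_mul _ (by fun_prop),
      lintegral_one_div_Ioo hbv hc, div_div_eq_mul_div]
  rw [h1, h2, lintegral_lintegral_swap hmeas.aemeasurable]

lemma lintegral_tsum_cubicKernel {a c : ℝ} (ha : 0 < a) (hc : 0 < c) :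
    ∫⁻ s in Set.Ioo 0 c, ∑' k : ℕ+, ENNReal.ofReal (1 / s * cubicKernel ((k : ℕ) * a / s)) =
      ∫⁻ v in Set.Ioi 0,
        ENNReal.ofReal (cubicDensity v * (v * (c / a) - logSumDefect (v * (c / a)))) := by
  rw [lintegral_tsum fun k => by fun_prop]
  have hk (k : ℕ+) : (0 : ℝ) < (k : ℕ) := by exact_mod_cast k.pos
  simp_rw [fun k : ℕ+ => lintegral_one_div_mul_cubicKernel (mul_pos (hk k) ha) hc]
  rw [← lintegral_tsum fun k => by fun_prop]
  refine setLIntegral_congr_fun measurableSet_Ioi fun v hv => ?_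
  have hv0 : 0 < v := hv
  rw [ENNReal.tsum_mul_left, ENNReal.ofReal_mul (cubicDensity_nonneg hv0.le),
    ← tsum_ofReal_log_div (by positivity : 0 < v * (c / a))]
  congr! 5 with k
  have := hk k
  field_simp

lemma exp_lt_one_of_theta_nome {s : ℝ} (hs : 0 < s) : exp (-2 * π / (√3 * s)) < 1 := by
  have hpos : 0 < 2 * π / (√3 * s) := by positivity
  rw [exp_lt_one_iff, neg_mul, neg_div]
  linarith

lemma cubicKernel_nat_mul_eq {s : ℝ} (hs : 0 < s) (k : ℕ) :
    cubicKernel (k * (2 * π / √3) / s) =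
      exp (-2 * π / (√3 * s)) ^ k / (1 + exp (-2 * π / (√3 * s)) ^ k +
        (exp (-2 * π / (√3 * s)) ^ k) ^ 2) := by
  have : exp (-2 * π / (√3 * s)) ^ k = exp (-(k * (2 * π / √3) / s)) := by
    rw [← exp_nat_mul]
    congr 1
    field_simp
  rw [this, cubicKernel]

lemma summable_one_div_mul_cubicKernel {s : ℝ} (hs : 0 < s) :
    Summable fun k : ℕ+ => 1 / s * cubicKernel ((k : ℕ) * (2 * π / √3) / s) := by
  simp_rw [cubicKernel_nat_mul_eq hs]
  exact (summable_lambert (exp_pos _).le (exp_lt_one_of_theta_nome hs)).mul_left _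

lemma one_div_mul_cubicTheta_sub_one {s : ℝ} (hs : 0 < s) :
    (1 / (2 * s)) * (cubicTheta (exp (-2 * π / (√3 * s))) - 1) =
      3 * (∑' k : ℕ+, ENNReal.ofReal
        (1 / s * cubicKernel ((k : ℕ) * (2 * π / √3) / s))).toReal := by
  have h0 (k : ℕ+) : 0 ≤ 1 / s * cubicKernel ((k : ℕ) * (2 * π / √3) / s) :=
    mul_nonneg (by positivity) (cubicKernel_nonneg _)
  rw [← ENNReal.ofReal_tsum_of_nonneg h0 (summable_one_div_mul_cubicKernel hs),
    ENNReal.toReal_ofReal (tsum_nonneg h0), tsum_mul_left,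
    cubicTheta_sub_one (exp_pos _) (exp_lt_one_of_theta_nome hs)]
  simp_rw [cubicKernel_nat_mul_eq hs]
  ring

lemma setIntegral_theta_eq {c : ℝ} (hc : 0 < c) :
    ∫ s in Set.Ioo 0 c, (1 / (2 * s)) * (cubicTheta (exp (-2 * π / (√3 * s))) - 1) =
      3 * ∫ v in Set.Ioi (0 : ℝ), cubicDensity v *
        (v * (c / (2 * π / √3)) - logSumDefect (v * (c / (2 * π / √3)))) := by
  have ha : 0 < 2 * π / √3 := by positivity
  rw [setIntegral_congr_fun measurableSet_Ioo fun s hs => one_div_mul_cubicTheta_sub_one hs.1,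
    integral_const_mul]
  congr 1
  rw [integral_eq_lintegral_of_nonneg_ae (f := fun v => cubicDensity v * _),
    ← lintegral_tsum_cubicKernel ha hc, integral_toReal]
  · fun_prop
  · filter_upwards [ae_restrict_mem measurableSet_Ioo] with s hs
    rw [← ENNReal.ofReal_tsum_of_nonneg]
    · exact ENNReal.ofReal_lt_top
    · exact fun k => mul_nonneg (one_div_nonneg.mpr hs.1.le) (cubicKernel_nonneg _)
    · exact summable_one_div_mul_cubicKernel hs.1
  · filter_upwards [ae_restrict_mem measurableSet_Ioi] with v hv
    have hv0 : 0 < v := hv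
    exact mul_nonneg (cubicDensity_nonneg hv0.le)
      (sub_nonneg.mpr (logSumDefect_le (by positivity)))
  · fun_prop

lemma integral_cubicDensity_mul_sub_logSumDefect {Λ : ℝ} (hΛ : 1 ≤ Λ) :
    ∫ v in Set.Ioi (0 : ℝ), cubicDensity v * (v * Λ - logSumDefect (v * Λ)) =
      Λ * (π / (3 * √3)) - log Λ / 6 - (∫ v in Set.Ioi (0 : ℝ), log v * cubicDensity v) / 2 -
        ∫ v in Set.Ioi (0 : ℝ),
          cubicDensity v * (logSumDefect (v * Λ) - log (v * Λ) / 2) := by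
  have i1 := integrableOn_id_mul_cubicDensity.const_mul Λ
  have i2 := integrableOn_cubicDensity.const_mul (log Λ / 2)
  have i3 := integrableOn_log_mul_cubicDensity.div_const 2
  have i4 := integrableOn_cubicDensity_mul_logSumDefect_sub hΛ
  have e : log Λ / 6 = log Λ / 2 * ∫ v in Set.Ioi (0 : ℝ), cubicDensity v := by
    rw [integral_cubicDensity_Ioi le_rfl, cubicKernel_zero]
    ring
  rw [← integral_id_mul_cubicDensity, e, ← integral_const_mul, ← integral_const_mul,
    ← integral_div, ← integral_sub i1 i2]
  erw [← integral_sub (i1.sub i2) i3, ← integral_sub ((i1.sub i2).sub i3) i4]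
  refine setIntegral_congr_fun measurableSet_Ioi fun v hv => ?_
  have hv0 : v ≠ 0 := ne_of_gt hv
  simp only [Pi.sub_apply, log_mul hv0 (by linarith : Λ ≠ 0)]
  ring

lemma log_sqrt_pi_div_Gamma :
    log 2 + log 3 / 4 - 3 / 2 * (log (Gamma (1 / 3)) - log (Gamma (2 / 3))) =
      2 * log 2 + (1 / 2) * log (2 / 3) + 3 * log (√π / Gamma (1 / 3)) := by
  have h3 : 0 < Gamma (1 / 3) := Gamma_pos_of_pos (by norm_num)
  have h6 : 0 < Gamma (2 / 3) := Gamma_pos_of_pos (by norm_num)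
  have h := Gamma_mul_Gamma_one_sub (1 / 3)
  rw [show (1 : ℝ) - 1 / 3 = 2 / 3 by norm_num, mul_one_div, sin_pi_div_three] at h
  have h' := congrArg log h
  rw [log_mul h3.ne' h6.ne', log_div pi_ne_zero (by positivity), log_div (by positivity)
    two_ne_zero, log_sqrt (by norm_num)] at h'
  rw [log_div two_ne_zero three_ne_zero, log_div (by positivity) h3.ne', log_sqrt pi_pos.le]
  linarith

theorem cBHS_formula :
    Tendsto
      (fun c : ℝ =>
        (∫ s in Set.Ioo (0 : ℝ) c,
          (1 / (2 * s)) * (cubicTheta (Real.exp (-2 * π / (Real.sqrt 3 * s))) - 1))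
        - c / 2 + Real.log (4 * c) / 2 - Real.eulerMascheroniConstant / 2)
      Filter.atTop
      (nhds (2 * Real.log 2 + (1 / 2) * Real.log (2 / 3)
        + 3 * Real.log (Real.sqrt π / Real.Gamma (1 / 3)))) := by
  have ha : 0 < 2 * π / √3 := by positivity
  have hdiv : Tendsto (fun c : ℝ => c / (2 * π / √3)) atTop atTop :=
    tendsto_id.atTop_div_const ha
  have h := ((tendsto_integral_cubicDensity_mul_logSumDefect_sub.comp hdiv).const_mul 3).const_sub
    (log 4 / 2 + log (2 * π / √3) / 2 -
      3 / 2 * (∫ v in Set.Ioi (0 : ℝ), log v * cubicDensity v) - eulerMascheroniConstant / 2)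
  have hlim : log 4 / 2 + log (2 * π / √3) / 2 -
      3 / 2 * (∫ v in Set.Ioi (0 : ℝ), log v * cubicDensity v) - eulerMascheroniConstant / 2 -
      3 * (log (2 * π) / 6) = 2 * log 2 + (1 / 2) * log (2 / 3) + 3 * log (√π / Gamma (1 / 3)) := by
    rw [← log_sqrt_pi_div_Gamma, integral_log_mul_cubicDensity, log_div (by positivity)
      (by positivity), log_sqrt (by norm_num), show (4 : ℝ) = 2 ^ 2 by norm_num, log_pow]
    push_cast
    ring
  rw [hlim] at h
  refine h.congr' ?_
  filter_upwards [eventually_gt_atTop 0, hdiv.eventually_ge_atTop 1] with c hc hΛ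
  rw [setIntegral_theta_eq hc, integral_cubicDensity_mul_sub_logSumDefect hΛ,
    log_div hc.ne' ha.ne', log_mul (by norm_num) hc.ne']
  have : c / (2 * π / √3) * (π / (3 * √3)) = c / 6 := by
    field_simp
    norm_num
  simp only [Function.comp_apply]
  linarith
end
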